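/- Let (Ω, F, P) be a probability space and Y = (Y_t)_{t≥0} a jointly measurable real-valued stochastic process such that there is an even function r : ℝ → ℝ with r(0) = 1 and, for every finite collection t₁, …, t_k ≥ 0 and reals c₁, …, c_k, the random variable Σᵢ cᵢ·Y_{tᵢ} is centered Gaussian with variance Σᵢ Σⱼ cᵢ·cⱼ·r(tᵢ − tⱼ). Assume r ∈ L¹(ℝ). Let α₊, α₋ > 0 with α₊ ≠ α₋, let X_t = α₊·Y_t·1_{Y_t>0} + α₋·Y_t·1_{Y_t<0}, let μ̂_i(T) = (1/T)·∫₀^T X_u^i du, and let μ₁ = (α₊ − α₋)/√(2π), μ₂ = (α₊² + α₋²)/2. Then there exists a symmetric positive semidefinite 2×2 real matrix Σ such that the ℝ²-valued random vectors √T·(μ̂₁(T) − μ₁, μ̂₂(T) − μ₂) converge in distribution, as T → ∞, to a centered bivariate Gaussian vector with covariance matrix Σ. -/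

import Mathlib

open MeasureTheory ProbabilityTheory Real Filter Set

/-- The second mixed moment `E[ξ η]` of two real random variables. -/
noncomputable def mixedMoment {Ω : Type*} [MeasurableSpace Ω] (P : Measure Ω) (ξ η : Ω → ℝ) : ℝ :=
  ∫ ω, ξ ω * η ω ∂P

/-- A vector space of random variables, each of which is centered Gaussian. -/
structure IsGaussianSpace {Ω : Type*} [MeasurableSpace Ω] (P : Measure Ω)
    (V : Submodule ℝ (Ω → ℝ)) : Prop where
  measurable : ∀ ξ ∈ V, Measurable ξ
  map_eq : ∀ ξ ∈ V, ∃ v, P.map ξ = gaussianReal 0 v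

namespace IsGaussianSpace

variable {Ω : Type*} [MeasurableSpace Ω] {P : Measure Ω}
  {V : Submodule ℝ (Ω → ℝ)} {ξ η : Ω → ℝ}

lemma memLp_two (hV : IsGaussianSpace P V) (hξ : ξ ∈ V) : MemLp ξ 2 P := by
  obtain ⟨v, hv⟩ := hV.map_eq ξ hξ
  have h : MemLp id 2 (P.map ξ) := by rw [hv]; exact memLp_id_gaussianReal 2
  exact (memLp_map_measure_iff aestronglyMeasurable_id (hV.measurable ξ hξ).aemeasurable).1 h

lemma integrable_mul (hV : IsGaussianSpace P V) (hξ : ξ ∈ V) (hη : η ∈ V) :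
    Integrable (fun ω => ξ ω * η ω) P :=
  (hV.memLp_two hξ).integrable_mul (hV.memLp_two hη)

lemma map_eq_mixedMoment (hV : IsGaussianSpace P V) (hξ : ξ ∈ V) :
    P.map ξ = gaussianReal 0 (mixedMoment P ξ ξ).toNNReal := by
  obtain ⟨v, hv⟩ := hV.map_eq ξ hξ
  have hm := hV.measurable ξ hξ
  have h1 : mixedMoment P ξ ξ = v := by
    have h2 : ∫ x, x ^ 2 ∂(P.map ξ) = mixedMoment P ξ ξ := by
      rw [integral_map hm.aemeasurable (by fun_prop)]
      simp [mixedMoment, sq]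
    rw [← h2, hv]
    have h3 := variance_fun_id_gaussianReal (μ := 0) (v := v)
    rw [variance_of_integral_eq_zero (by fun_prop) (by simp)] at h3
    simpa using h3
  rw [hv, h1]; simp

lemma integral_cexp (hV : IsGaussianSpace P V) (hξ : ξ ∈ V) :
    ∫ ω, Complex.exp (ξ ω * Complex.I) ∂P = Complex.exp (-(mixedMoment P ξ ξ : ℂ) / 2) := by
  have hm := hV.measurable ξ hξ
  have h := charFun_gaussianReal (μ := 0) (v := (mixedMoment P ξ ξ).toNNReal) 1
  rw [← hV.map_eq_mixedMoment hξ, charFun_apply_real,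
    integral_map hm.aemeasurable (by fun_prop)] at h
  have h0 : 0 ≤ mixedMoment P ξ ξ := integral_nonneg fun ω => mul_self_nonneg _
  simpa [Real.coe_toNNReal _ h0, neg_div] using h

lemma mixedMoment_smul_add (hV : IsGaussianSpace P V) (hξ : ξ ∈ V) (hη : η ∈ V) (s : ℝ) :
    mixedMoment P (s • ξ + η) (s • ξ + η)
      = s ^ 2 * mixedMoment P ξ ξ + 2 * s * mixedMoment P ξ η + mixedMoment P η η := by
  have h : ∀ ω, (s • ξ + η) ω * (s • ξ + η) ω
      = s ^ 2 * (ξ ω * ξ ω) + 2 * s * (ξ ω * η ω) + η ω * η ω := by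
    intro ω; simp; ring
  simp only [mixedMoment, h]
  have a := (hV.integrable_mul hξ hξ).const_mul (s ^ 2)
  have b := (hV.integrable_mul hξ hη).const_mul (2 * s)
  rw [integral_add (f := fun ω => s ^ 2 * (ξ ω * ξ ω) + 2 * s * (ξ ω * η ω)) (a.add b)
    (hV.integrable_mul hη hη), integral_add a b, integral_const_mul,
    integral_const_mul]

lemma integral_cexp_smul_add (hV : IsGaussianSpace P V) (hξ : ξ ∈ V) (hη : η ∈ V) (s : ℝ) :
    ∫ ω, Complex.exp (s * ξ ω * Complex.I) * Complex.exp (η ω * Complex.I) ∂P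
      = Complex.exp (-(s ^ 2 * mixedMoment P ξ ξ + 2 * s * mixedMoment P ξ η
          + mixedMoment P η η : ℝ) / 2) := by
  rw [← hV.mixedMoment_smul_add hξ hη, ← hV.integral_cexp (V.add_mem (V.smul_mem s hξ) hη)]
  congr 1; ext ω
  rw [← Complex.exp_add]
  simp; ring_nf

lemma mixedMoment_add_right (hV : IsGaussianSpace P V) (hξ : ξ ∈ V) (hη : η ∈ V)
    {ζ : Ω → ℝ} (hζ : ζ ∈ V) :
    mixedMoment P ξ (η + ζ) = mixedMoment P ξ η + mixedMoment P ξ ζ := by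
  simp only [mixedMoment, Pi.add_apply, mul_add]
  exact integral_add (hV.integrable_mul hξ hη) (hV.integrable_mul hξ hζ)

lemma sq_mixedMoment_le (hV : IsGaussianSpace P V) (hξ : ξ ∈ V) (hη : η ∈ V) :
    2 * |mixedMoment P ξ η| ≤ mixedMoment P ξ ξ + mixedMoment P η η := by
  have h := fun s => hV.mixedMoment_smul_add hξ hη s
  have h0 : ∀ ζ : Ω → ℝ, 0 ≤ mixedMoment P ζ ζ :=
    fun ζ => integral_nonneg fun ω => mul_self_nonneg _
  have h1 := h 1 ▸ h0 _
  have h2 := h (-1) ▸ h0 _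
  rcases abs_cases (mixedMoment P ξ η) with ⟨h, _⟩ | ⟨h, _⟩ <;> rw [h] <;> linarith

end IsGaussianSpace

/-- A bounded superposition of complex exponentials `κ a * exp (i U_a)` of Gaussian variables
`U_a`, indexed by a finite measure space. -/
structure IsExpFamily {Ω A : Type*} [MeasurableSpace Ω] [MeasurableSpace A] (P : Measure Ω)
    (V : Submodule ℝ (Ω → ℝ)) (κ : A → ℂ) (U : A × Ω → ℝ) (C : ℝ) : Prop where
  gaussian : IsGaussianSpace P V
  measurable_coeff : Measurable κ
  measurable : Measurable U
  mem : ∀ a, (fun ω => U (a, ω)) ∈ V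
  norm_coeff_le : ∀ a, ‖κ a‖ ≤ C
  mixedMoment_le : ∀ a, mixedMoment P (fun ω => U (a, ω)) (fun ω => U (a, ω)) ≤ C

section
variable {Ω A : Type*} [MeasurableSpace Ω] [MeasurableSpace A]

/-- The random variable `∫ κ a * exp (i U_a) dα(a)`. -/
noncomputable def expSum (α : Measure A) (κ : A → ℂ) (U : A × Ω → ℝ) (ω : Ω) : ℂ :=
  ∫ a, κ a * Complex.exp (U (a, ω) * Complex.I) ∂α

/-- The Malliavin derivative of `expSum α κ U` in the direction of a Gaussian variable `ξ`. -/
noncomputable def expSumDeriv (P : Measure Ω) (α : Measure A) (κ : A → ℂ) (U : A × Ω → ℝ)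
    (ξ : Ω → ℝ) (ω : Ω) : ℂ :=
  Complex.I * ∫ a, κ a * mixedMoment P ξ (fun ω => U (a, ω)) * Complex.exp (U (a, ω) * Complex.I) ∂α

/-- The Mehler weight `exp (-(1 - s²) E[ξ²] / 2)`, truncated to `1` for `s ∉ [-1, 1]`. -/
noncomputable def mehlerWeight (P : Measure Ω) (ξ : Ω → ℝ) (s : ℝ) : ℝ :=
  Real.exp (-max 0 (1 - s ^ 2) * mixedMoment P ξ ξ / 2)

variable {P : Measure Ω} {V : Submodule ℝ (Ω → ℝ)} {α : Measure A}
  {κ : A → ℂ} {U : A × Ω → ℝ} {C : ℝ} {ξ η : Ω → ℝ}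

@[fun_prop]
lemma continuous_mehlerWeight (P : Measure Ω) (ξ : Ω → ℝ) : Continuous (mehlerWeight P ξ) := by
  unfold mehlerWeight; fun_prop

lemma norm_mehlerWeight_le_one (P : Measure Ω) (ξ : Ω → ℝ) (s : ℝ) :
    ‖(mehlerWeight P ξ s : ℂ)‖ ≤ 1 := by
  have h0 : 0 ≤ mixedMoment P ξ ξ := integral_nonneg fun ω => mul_self_nonneg _
  rw [Complex.norm_real, Real.norm_of_nonneg (by unfold mehlerWeight; positivity), mehlerWeight,
    Real.exp_le_one_iff]
  have : 0 ≤ max 0 (1 - s ^ 2) * mixedMoment P ξ ξ := by positivity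
  linarith

/-- Gaussian interpolation formula for the covariance of two exponentials. -/
lemma IsGaussianSpace.integral_cexp_sub_mul_cexp [IsProbabilityMeasure P]
    (hV : IsGaussianSpace P V) (hξ : ξ ∈ V)
    (hη : η ∈ V) :
    ∫ ω, (Complex.exp (ξ ω * Complex.I) - ∫ ω, Complex.exp (ξ ω * Complex.I) ∂P)
        * Complex.exp (η ω * Complex.I) ∂P
      = ∫ s in Set.Ioc (0 : ℝ) 1, ∫ ω, mehlerWeight P ξ s * Complex.exp (s * ξ ω * Complex.I)
        * Complex.exp (η ω * Complex.I) * (-(mixedMoment P ξ η)) ∂P := by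
  have m1 := hV.measurable ξ hξ
  have m2 := hV.measurable η hη
  set F : ℝ → ℂ := fun s => Complex.exp (-(mixedMoment P ξ ξ + 2 * s * mixedMoment P ξ η
          + mixedMoment P η η : ℝ) / 2) with hF
  have hderiv : ∀ s, HasDerivAt F (-(mixedMoment P ξ η) * F s) s := by
    intro s
    have h1 : HasDerivAt (fun s : ℝ => (-(mixedMoment P ξ ξ + 2 * s * mixedMoment P ξ η
          + mixedMoment P η η) / 2 : ℝ)) (-(mixedMoment P ξ η)) s := by
      have := (((((hasDerivAt_id s).const_mul 2).mul_const (mixedMoment P ξ η)).const_add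
        (mixedMoment P ξ ξ)).add_const (mixedMoment P η η)).neg.div_const 2
      refine (this.congr_deriv (by ring)).congr_of_eventuallyEq (Eventually.of_forall fun x => ?_)
      simp
    have h2 := h1.ofReal_comp.cexp
    convert h2 using 1
    · ext s; simp [hF]
    · simp [hF]; ring
  have hint : IntervalIntegrable (fun s => -(mixedMoment P ξ η : ℂ) * F s) volume 0 1 := by
    apply Continuous.intervalIntegrable
    simp only [hF]; fun_prop
  have key := intervalIntegral.integral_eq_sub_of_hasDerivAt (fun s _ => hderiv s) hint
  rw [intervalIntegral.integral_of_le zero_le_one] at key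
  have hi : ∀ ζ : Ω → ℝ, Measurable ζ → Integrable (fun ω => Complex.exp (ζ ω * Complex.I)) P := by
    intro ζ hζ
    exact Integrable.of_bound (by fun_prop) 1 (ae_of_all _ fun ω => by
      simp [Complex.norm_exp_ofReal_mul_I])
  have e1 : ∫ ω, (Complex.exp (ξ ω * Complex.I) - ∫ ω, Complex.exp (ξ ω * Complex.I) ∂P)
        * Complex.exp (η ω * Complex.I) ∂P = F 1 - F 0 := by
    simp only [sub_mul]
    rw [integral_sub, integral_const_mul, hV.integral_cexp hξ, hV.integral_cexp hη,
      ← Complex.exp_add]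
    · have := hV.integral_cexp_smul_add hξ hη 1
      simp only [Complex.ofReal_one, one_mul] at this
      rw [this]
      simp only [hF]
      congr 2 <;> push_cast <;> ring
    · have := hi (ξ + η) (by fun_prop)
      refine this.congr (ae_of_all _ fun ω => ?_)
      simp only [← Complex.exp_add]; simp; ring_nf
    · exact (hi η m2).const_mul _
  rw [e1, ← key]
  refine setIntegral_congr_fun measurableSet_Ioc fun s hs => ?_
  have hs' : 0 ≤ 1 - s ^ 2 := by nlinarith [hs.1, hs.2]
  rw [integral_mul_const]
  simp only [mul_assoc (mehlerWeight P ξ s : ℂ)]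
  rw [integral_const_mul, hV.integral_cexp_smul_add hξ hη s, mehlerWeight,
    max_eq_right hs', Complex.ofReal_exp,
    ← Complex.exp_add, mul_comm]
  simp only [hF]
  congr 2; push_cast; ring

lemma IsExpFamily.measurable_mixedMoment [IsProbabilityMeasure P]
    (h : IsExpFamily P V κ U C) (hξ : ξ ∈ V) :
    Measurable (fun a => mixedMoment P ξ (fun ω => U (a, ω))) := by
  have m1 := h.gaussian.measurable ξ hξ
  have mU := h.measurable
  exact (StronglyMeasurable.integral_prod_right' (f := fun p : A × Ω => ξ p.2 * U p)
    (by fun_prop : Measurable _).stronglyMeasurable).measurable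

lemma IsExpFamily.measurable_expSum [IsFiniteMeasure α] (h : IsExpFamily P V κ U C) :
    Measurable (expSum α κ U) := by
  have mU := h.measurable
  have mκ := h.measurable_coeff
  exact (StronglyMeasurable.integral_prod_left'
    (f := fun p : A × Ω => κ p.1 * Complex.exp (U (p.1, p.2) * Complex.I))
    (by fun_prop : Measurable _).stronglyMeasurable).measurable

lemma IsExpFamily.measurable_expSumDeriv [IsProbabilityMeasure P] [IsFiniteMeasure α]
    (h : IsExpFamily P V κ U C) (hξ : ξ ∈ V) :
    Measurable (expSumDeriv P α κ U ξ) := by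
  have mU := h.measurable
  have mκ := h.measurable_coeff
  have mm : Measurable (fun p : A × Ω => mixedMoment P ξ (fun ω => U (p.1, ω))) :=
    (h.measurable_mixedMoment hξ).comp measurable_fst
  exact ((StronglyMeasurable.integral_prod_left'
    (f := fun p : A × Ω => κ p.1 * mixedMoment P ξ (fun ω => U (p.1, ω))
      * Complex.exp (U (p.1, p.2) * Complex.I))
    (by fun_prop : Measurable _).stronglyMeasurable).measurable).const_mul _

lemma IsExpFamily.nonneg (h : IsExpFamily P V κ U C) (a : A) : 0 ≤ C :=
  (norm_nonneg _).trans (h.norm_coeff_le a)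

lemma IsExpFamily.norm_expSum_le [IsFiniteMeasure α] (h : IsExpFamily P V κ U C) (ω : Ω) :
    ‖expSum α κ U ω‖ ≤ C * α.real univ := by
  refine (norm_integral_le_of_norm_le_const (ae_of_all _ fun a => ?_))
  simpa [Complex.norm_exp_ofReal_mul_I] using h.norm_coeff_le a

lemma norm_expSumDeriv_le (ω : Ω) :
    ‖expSumDeriv P α κ U ξ ω‖ ≤ ∫ a, ‖κ a‖ * |mixedMoment P ξ (fun ω => U (a, ω))| ∂α := by
  rw [expSumDeriv, norm_mul, Complex.norm_I, one_mul]
  refine (norm_integral_le_integral_norm _).trans_eq ?_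
  simp [Complex.norm_exp_ofReal_mul_I]

lemma IsExpFamily.abs_mixedMoment_le (h : IsExpFamily P V κ U C) (hξ : ξ ∈ V) (a : A) :
    |mixedMoment P ξ (fun ω => U (a, ω))| ≤ mixedMoment P ξ ξ + C := by
  have h1 := h.gaussian.sq_mixedMoment_le hξ (h.mem a)
  have h2 := h.mixedMoment_le a
  have := abs_nonneg (mixedMoment P ξ (fun ω => U (a, ω)))
  linarith

end

section
variable {Ω A : Type*} [MeasurableSpace Ω] [MeasurableSpace A]

lemma integral_integral_swap_of_norm_le {X Y : Type*} [MeasurableSpace X] [MeasurableSpace Y]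
    {μ : Measure X} {ν : Measure Y} [IsFiniteMeasure μ] [IsFiniteMeasure ν] {f : X → Y → ℂ}
    (hf : Measurable (Function.uncurry f)) (B : ℝ) (hB : ∀ x y, ‖f x y‖ ≤ B) :
    ∫ x, ∫ y, f x y ∂ν ∂μ = ∫ y, ∫ x, f x y ∂μ ∂ν :=
  integral_integral_swap (Integrable.of_bound hf.aestronglyMeasurable B
    (ae_of_all _ fun p => hB p.1 p.2))

variable {P : Measure Ω} [IsProbabilityMeasure P] {V : Submodule ℝ (Ω → ℝ)} {α : Measure A}
  [IsFiniteMeasure α] {κ : A → ℂ} {U : A × Ω → ℝ} {C : ℝ} {ξ η : Ω → ℝ}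

/-- Gaussian integration by parts against the powers of `expSum`. -/
lemma IsExpFamily.integral_cexp_sub_mul_pow (h : IsExpFamily P V κ U C) (hξ : ξ ∈ V) (n : ℕ) :
    ∀ η ∈ V, ∫ ω, (Complex.exp (ξ ω * Complex.I) - ∫ ω, Complex.exp (ξ ω * Complex.I) ∂P)
        * Complex.exp (η ω * Complex.I) * expSum α κ U ω ^ n ∂P
      = ∫ p, mehlerWeight P ξ p.2 * Complex.exp (p.2 * ξ p.1 * Complex.I)
        * Complex.exp (η p.1 * Complex.I)
        * (-(mixedMoment P ξ η) * expSum α κ U p.1 ^ n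
          + Complex.I * n * expSum α κ U p.1 ^ (n - 1) * expSumDeriv P α κ U ξ p.1)
        ∂(P.prod (volume.restrict (Set.Ioc (0 : ℝ) 1))) := by
  have mξ := h.gaussian.measurable ξ hξ
  have mU := h.measurable
  have mκ := h.measurable_coeff
  have mZ := h.measurable_expSum (α := α)
  have mD := h.measurable_expSumDeriv (α := α) hξ
  have mc := h.measurable_mixedMoment hξ
  have hC : ∀ a, 0 ≤ C := h.nonneg
  have hZ := h.norm_expSum_le (α := α)
  obtain ⟨M, hM⟩ : ∃ M, ∀ ω, ‖expSumDeriv P α κ U ξ ω‖ ≤ M := ⟨_, norm_expSumDeriv_le⟩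
  have hce : ∀ x : ℝ, ‖Complex.exp (x * Complex.I)‖ = 1 := Complex.norm_exp_ofReal_mul_I
  induction n with
  | zero =>
    intro η hη
    have mη := h.gaussian.measurable η hη
    have := h.gaussian.integral_cexp_sub_mul_cexp hξ hη
    simp only [pow_zero, mul_one, Nat.cast_zero, mul_zero, zero_mul, add_zero]
    rw [this, integral_prod_symm]
    have mw := (continuous_mehlerWeight P ξ).measurable
    refine Integrable.of_bound (by fun_prop) |mixedMoment P ξ η| (ae_of_all _ fun p => ?_)
    rw [norm_mul, norm_mul, norm_mul, hce, ← Complex.ofReal_mul, hce, norm_neg, mul_one, mul_one,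
      Complex.norm_real (mixedMoment P ξ η)]
    exact mul_le_of_le_one_left (abs_nonneg _) (norm_mehlerWeight_le_one P ξ p.2)
  | succ n ih =>
    intro η hη
    have mη := h.gaussian.measurable η hη
    set m := ∫ ω, Complex.exp (ξ ω * Complex.I) ∂P with hm
    have hm1 : ‖m‖ ≤ 1 := by
      refine (norm_integral_le_of_norm_le_const (ae_of_all _ fun ω => (hce (ξ ω)).le)).trans ?_
      simp
    have e1 : ∀ ω, (Complex.exp (ξ ω * Complex.I) - m)
        * Complex.exp (η ω * Complex.I) * expSum α κ U ω ^ (n + 1)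
        = ∫ a, κ a * ((Complex.exp (ξ ω * Complex.I) - m)
          * Complex.exp ((η + fun ω => U (a, ω)) ω * Complex.I) * expSum α κ U ω ^ n) ∂α := by
      intro ω
      rw [pow_succ, ← mul_assoc]
      conv_lhs => arg 2; rw [expSum]
      rw [← integral_const_mul]
      refine integral_congr_ae (ae_of_all _ fun a => ?_)
      beta_reduce
      rw [Pi.add_apply, Complex.ofReal_add, add_mul, Complex.exp_add]
      ring
    have e2 : ∀ p : Ω × ℝ, mehlerWeight P ξ p.2 * Complex.exp (p.2 * ξ p.1 * Complex.I)
        * Complex.exp (η p.1 * Complex.I)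
        * (-(mixedMoment P ξ η) * expSum α κ U p.1 ^ (n + 1)
          + Complex.I * (n + 1 : ℕ) * expSum α κ U p.1 ^ (n + 1 - 1) * expSumDeriv P α κ U ξ p.1)
        = ∫ a, κ a * (mehlerWeight P ξ p.2 * Complex.exp (p.2 * ξ p.1 * Complex.I)
        * Complex.exp ((η + fun ω => U (a, ω)) p.1 * Complex.I)
        * (-(mixedMoment P ξ η + mixedMoment P ξ (fun ω => U (a, ω))) * expSum α κ U p.1 ^ n
          + Complex.I * n * expSum α κ U p.1 ^ (n - 1) * expSumDeriv P α κ U ξ p.1)) ∂α := by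
      intro p
      have i1 : Integrable (fun a => κ a * Complex.exp (U (a, p.1) * Complex.I)) α :=
        Integrable.of_bound (by fun_prop) C (ae_of_all _ fun a => by
          simpa [hce] using h.norm_coeff_le a)
      have i2 : Integrable (fun a => κ a * mixedMoment P ξ (fun ω => U (a, ω))
          * Complex.exp (U (a, p.1) * Complex.I)) α :=
        Integrable.of_bound (by fun_prop) (C * (mixedMoment P ξ ξ + C)) (ae_of_all _ fun a => by
          rw [norm_mul, norm_mul, hce, mul_one, Complex.norm_real]
          exact mul_le_mul (h.norm_coeff_le a) (h.abs_mixedMoment_le hξ a) (norm_nonneg _) (hC a))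
      have e3 : ∀ a, κ a * (mehlerWeight P ξ p.2 * Complex.exp (p.2 * ξ p.1 * Complex.I)
        * Complex.exp ((η + fun ω => U (a, ω)) p.1 * Complex.I)
        * (-(mixedMoment P ξ η + mixedMoment P ξ (fun ω => U (a, ω))) * expSum α κ U p.1 ^ n
          + Complex.I * n * expSum α κ U p.1 ^ (n - 1) * expSumDeriv P α κ U ξ p.1))
        = (mehlerWeight P ξ p.2 * Complex.exp (p.2 * ξ p.1 * Complex.I)
            * Complex.exp (η p.1 * Complex.I) * (-(mixedMoment P ξ η) * expSum α κ U p.1 ^ n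
          + Complex.I * n * expSum α κ U p.1 ^ (n - 1) * expSumDeriv P α κ U ξ p.1))
            * (κ a * Complex.exp (U (a, p.1) * Complex.I))
          + (mehlerWeight P ξ p.2 * Complex.exp (p.2 * ξ p.1 * Complex.I)
            * Complex.exp (η p.1 * Complex.I) * -expSum α κ U p.1 ^ n)
            * (κ a * mixedMoment P ξ (fun ω => U (a, ω)) * Complex.exp (U (a, p.1) * Complex.I)) := by
        intro a
        rw [Pi.add_apply, Complex.ofReal_add,
          add_mul, Complex.exp_add]
        ring
      simp only [e3]
      rw [integral_add (i1.const_mul _) (i2.const_mul _), integral_const_mul, integral_const_mul]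
      have e4 : ∫ a, κ a * Complex.exp (U (a, p.1) * Complex.I) ∂α = expSum α κ U p.1 := rfl
      have e5 : ∫ a, κ a * mixedMoment P ξ (fun ω => U (a, ω))
          * Complex.exp (U (a, p.1) * Complex.I) ∂α
          = -Complex.I * expSumDeriv P α κ U ξ p.1 := by
        rw [expSumDeriv, ← mul_assoc]; simp
      rw [e4, e5]
      rcases n with _ | n
      · simp; ring
      · simp only [Nat.add_sub_cancel]; push_cast; ring
    simp only [e1, e2]
    rw [integral_integral_swap_of_norm_le (μ := P) (ν := α) (B := C * (2 * (C * α.real univ) ^ n)),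
      integral_integral_swap_of_norm_le
        (μ := P.prod (volume.restrict (Set.Ioc (0 : ℝ) 1))) (ν := α)
        (B := C * ((mixedMoment P ξ ξ + |mixedMoment P ξ η| + C) * (C * α.real univ) ^ n
          + n * (C * α.real univ) ^ (n - 1) * M))]
    · refine integral_congr_ae (ae_of_all _ fun a => ?_)
      beta_reduce
      rw [integral_const_mul, integral_const_mul, ih _ (V.add_mem hη (h.mem a)),
        h.gaussian.mixedMoment_add_right hξ hη (h.mem a), Complex.ofReal_add]
    · have mw := (continuous_mehlerWeight P ξ).measurable
      have mc' : Measurable (fun q : (Ω × ℝ) × A => mixedMoment P ξ (fun ω => U (q.2, ω))) :=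
        mc.comp measurable_snd
      simp only [Function.uncurry_def, Pi.add_apply]
      fun_prop
    · intro p a
      rw [norm_mul, norm_mul, norm_mul, norm_mul, hce, ← Complex.ofReal_mul, hce, mul_one, mul_one]
      have h1 : ‖(-(mixedMoment P ξ η + mixedMoment P ξ (fun ω => U (a, ω))) : ℂ)‖
          ≤ mixedMoment P ξ ξ + |mixedMoment P ξ η| + C := by
        rw [norm_neg, ← Complex.ofReal_add, Complex.norm_real, Real.norm_eq_abs]
        have := abs_add_le (mixedMoment P ξ η) (mixedMoment P ξ (fun ω => U (a, ω)))
        have := h.abs_mixedMoment_le hξ a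
        linarith
      have h2 : ‖(-(mixedMoment P ξ η + mixedMoment P ξ (fun ω => U (a, ω))) : ℂ)
          * expSum α κ U p.1 ^ n‖
          ≤ (mixedMoment P ξ ξ + |mixedMoment P ξ η| + C) * (C * α.real univ) ^ n := by
        rw [norm_mul, norm_pow]
        exact mul_le_mul h1 (pow_le_pow_left₀ (norm_nonneg _) (hZ _) n) (by positivity)
          ((norm_nonneg _).trans h1)
      have h3 : ‖Complex.I * n * expSum α κ U p.1 ^ (n - 1) * expSumDeriv P α κ U ξ p.1‖
          ≤ n * (C * α.real univ) ^ (n - 1) * M := by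
        have h0 : 0 ≤ C * α.real univ := (norm_nonneg _).trans (hZ p.1)
        rw [norm_mul, norm_mul, norm_mul, norm_pow, Complex.norm_I, one_mul, Complex.norm_natCast]
        gcongr
        · exact hZ _
        · exact hM _
      refine mul_le_mul (h.norm_coeff_le a) ?_ (by positivity) (hC a)
      refine (mul_le_of_le_one_left (norm_nonneg _) (norm_mehlerWeight_le_one P ξ p.2)).trans ?_
      exact (norm_add_le _ _).trans (add_le_add h2 h3)
    · simp only [Function.uncurry_def, Pi.add_apply]
      fun_prop
    · intro ω a
      rw [norm_mul, norm_mul, norm_mul, norm_pow, hce, mul_one]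
      refine mul_le_mul (h.norm_coeff_le a) ?_ (by positivity) (hC a)
      refine mul_le_mul ?_ (pow_le_pow_left₀ (norm_nonneg _) (hZ _) n) (by positivity) (by norm_num)
      refine (norm_sub_le _ _).trans ?_
      rw [hce]; linarith

end

lemma hasSum_cexp (x z : ℂ) :
    HasSum (fun n : ℕ => x ^ n / n.factorial * z ^ n) (Complex.exp (x * z)) := by
  rw [Complex.exp_eq_exp_ℂ]
  refine (NormedSpace.expSeries_div_hasSum_exp (x * z)).congr_fun ?_
  intro n
  rw [mul_pow]; ring

lemma hasSum_cexp_deriv (x z : ℂ) :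
    HasSum (fun n : ℕ => x ^ n / n.factorial * (n * z ^ (n - 1))) (x * Complex.exp (x * z)) := by
  rw [← hasSum_nat_add_iff' 1]
  simp only [Finset.range_one, Finset.sum_singleton, Nat.cast_zero, zero_mul, mul_zero, sub_zero]
  refine ((hasSum_cexp x z).mul_left x).congr_fun ?_
  intro n
  have : ((n : ℂ) + 1) ≠ 0 := by exact_mod_cast Nat.succ_ne_zero n
  have h2 : (n.factorial : ℂ) ≠ 0 := by exact_mod_cast n.factorial_ne_zero
  rw [Nat.factorial_succ]
  push_cast
  field_simp
  ring

section
variable {Ω A : Type*} [MeasurableSpace Ω] [MeasurableSpace A]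
variable {P : Measure Ω} [IsProbabilityMeasure P] {V : Submodule ℝ (Ω → ℝ)} {α : Measure A}
  [IsFiniteMeasure α] {κ : A → ℂ} {U : A × Ω → ℝ} {C : ℝ} {ξ η : Ω → ℝ}

lemma norm_integral_cexp_le_one (P : Measure Ω) [IsProbabilityMeasure P] (ξ : Ω → ℝ) :
    ‖∫ ω, Complex.exp (ξ ω * Complex.I) ∂P‖ ≤ 1 := by
  refine (norm_integral_le_of_norm_le_const
    (ae_of_all _ fun ω => (Complex.norm_exp_ofReal_mul_I (ξ ω)).le)).trans ?_
  simp

/-- Gaussian integration by parts against `expSum`. -/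
lemma IsExpFamily.integral_cexp_sub_mul_expSum (h : IsExpFamily P V κ U C) (hξ : ξ ∈ V) :
    ∫ ω, (Complex.exp (ξ ω * Complex.I) - ∫ ω, Complex.exp (ξ ω * Complex.I) ∂P)
        * expSum α κ U ω ∂P
      = ∫ p, mehlerWeight P ξ p.2 * Complex.exp (p.2 * ξ p.1 * Complex.I)
        * (Complex.I * expSumDeriv P α κ U ξ p.1 * 1)
        ∂(P.prod (volume.restrict (Set.Ioc (0 : ℝ) 1))) := by
  have := h.integral_cexp_sub_mul_pow (α := α) hξ 1 0 V.zero_mem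
  simpa [mixedMoment] using this

/-- Gaussian integration by parts against the exponential of `expSum`. -/
lemma IsExpFamily.integral_cexp_sub_mul_cexp (h : IsExpFamily P V κ U C) (hξ : ξ ∈ V) (t : ℂ) :
    ∫ ω, (Complex.exp (ξ ω * Complex.I) - ∫ ω, Complex.exp (ξ ω * Complex.I) ∂P)
        * Complex.exp (t * expSum α κ U ω) ∂P
      = ∫ p, mehlerWeight P ξ p.2 * Complex.exp (p.2 * ξ p.1 * Complex.I)
        * (Complex.I * expSumDeriv P α κ U ξ p.1 * (t * Complex.exp (t * expSum α κ U p.1)))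
        ∂(P.prod (volume.restrict (Set.Ioc (0 : ℝ) 1))) := by
  have mξ := h.gaussian.measurable ξ hξ
  have mZ := h.measurable_expSum (α := α)
  have mD := h.measurable_expSumDeriv (α := α) hξ
  have mw := (continuous_mehlerWeight P ξ).measurable
  have hZ := h.norm_expSum_le (α := α)
  set K := C * α.real univ
  obtain ⟨M, hM⟩ : ∃ M, ∀ ω, ‖expSumDeriv P α κ U ξ ω‖ ≤ M := ⟨_, norm_expSumDeriv_le⟩
  have hce : ∀ x : ℝ, ‖Complex.exp (x * Complex.I)‖ = 1 := Complex.norm_exp_ofReal_mul_I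
  set m := ∫ ω, Complex.exp (ξ ω * Complex.I) ∂P with hm
  have hm1 : ‖m‖ ≤ 1 := norm_integral_cexp_le_one P ξ
  have s1 : HasSum (fun n : ℕ => ∫ ω, (Complex.exp (ξ ω * Complex.I) - m)
      * (t ^ n / n.factorial * expSum α κ U ω ^ n) ∂P)
      (∫ ω, (Complex.exp (ξ ω * Complex.I) - m) * Complex.exp (t * expSum α κ U ω) ∂P) := by
    refine hasSum_integral_of_dominated_convergence
      (fun n _ => 2 * ‖t ^ n / n.factorial * (K : ℂ) ^ n‖) (fun n => by fun_prop) ?_ ?_ ?_ ?_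
    · refine fun n => ae_of_all _ fun ω => ?_
      rw [norm_mul, norm_mul, norm_mul, norm_pow, norm_pow, Complex.norm_real]
      gcongr
      · refine (norm_sub_le _ _).trans ?_
        rw [hce]; linarith
      · exact (hZ ω).trans (le_abs_self K)
    · exact ae_of_all _ fun ω => ((hasSum_cexp t K).summable.norm.mul_left 2)
    · exact integrable_const _
    · exact ae_of_all _ fun ω => (hasSum_cexp t _).mul_left _
  have s2 : HasSum (fun n : ℕ => ∫ p, mehlerWeight P ξ p.2 * Complex.exp (p.2 * ξ p.1 * Complex.I)
        * (Complex.I * expSumDeriv P α κ U ξ p.1 *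
          (t ^ n / n.factorial * (n * expSum α κ U p.1 ^ (n - 1))))
        ∂(P.prod (volume.restrict (Set.Ioc (0 : ℝ) 1))))
      (∫ p, mehlerWeight P ξ p.2 * Complex.exp (p.2 * ξ p.1 * Complex.I)
        * (Complex.I * expSumDeriv P α κ U ξ p.1 * (t * Complex.exp (t * expSum α κ U p.1)))
        ∂(P.prod (volume.restrict (Set.Ioc (0 : ℝ) 1)))) := by
    refine hasSum_integral_of_dominated_convergence
      (fun n _ => M * ‖t ^ n / n.factorial * (n * (K : ℂ) ^ (n - 1))‖)
      (fun n => by fun_prop) ?_ ?_ ?_ ?_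
    · refine fun n => ae_of_all _ fun p => ?_
      rw [norm_mul, norm_mul, ← Complex.ofReal_mul, hce, mul_one]
      refine (mul_le_of_le_one_left (norm_nonneg _) (norm_mehlerWeight_le_one P ξ p.2)).trans ?_
      rw [norm_mul, norm_mul, Complex.norm_I, one_mul, norm_mul, norm_mul, norm_mul, norm_mul,
        norm_pow, norm_pow, Complex.norm_real]
      have := (norm_nonneg _).trans (hM p.1)
      gcongr
      · exact hM _
      · exact (hZ p.1).trans (le_abs_self K)
    · exact ae_of_all _ fun ω => ((hasSum_cexp_deriv t K).summable.norm.mul_left M)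
    · exact integrable_const _
    · exact ae_of_all _ fun p => ((hasSum_cexp_deriv t _).mul_left _).mul_left _
  refine s1.unique (s2.congr_fun fun n => ?_)
  have := h.integral_cexp_sub_mul_pow (α := α) hξ n 0 V.zero_mem
  have e0 : mixedMoment P ξ 0 = 0 := by simp [mixedMoment]
  simp only [Pi.zero_apply, Complex.ofReal_zero, zero_mul, Complex.exp_zero, mul_one, e0,
    neg_zero, zero_add, ← hm] at this
  have a1 : ∀ ω, (Complex.exp (ξ ω * Complex.I) - m) * (t ^ n / n.factorial * expSum α κ U ω ^ n)
      = t ^ n / n.factorial * ((Complex.exp (ξ ω * Complex.I) - m) * expSum α κ U ω ^ n) :=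
    fun ω => by ring
  simp only [a1]
  rw [integral_const_mul, this, ← integral_const_mul]
  refine integral_congr_ae (ae_of_all _ fun p => ?_)
  ring

lemma IsExpFamily.norm_cov_cexp_le (h : IsExpFamily P V κ U C)
    (hreal : ∀ ω, (expSum α κ U ω).im = 0) (hξ : ξ ∈ V) (t : ℝ) :
    ‖∫ ω, (Complex.exp (ξ ω * Complex.I) - ∫ ω, Complex.exp (ξ ω * Complex.I) ∂P)
        * Complex.exp (t * Complex.I * expSum α κ U ω) ∂P‖
      ≤ |t| * ∫ a, ‖κ a‖ * |mixedMoment P ξ (fun ω => U (a, ω))| ∂α := by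
  rw [h.integral_cexp_sub_mul_cexp hξ]
  refine (norm_integral_le_of_norm_le_const (ae_of_all _ fun p => ?_)).trans_eq
    (by simp [Measure.real, Measure.prod_apply] :
      (|t| * ∫ a, ‖κ a‖ * |mixedMoment P ξ (fun ω => U (a, ω))| ∂α) * _ = _)
  rw [norm_mul, norm_mul, ← Complex.ofReal_mul, Complex.norm_exp_ofReal_mul_I, mul_one]
  refine (mul_le_of_le_one_left (norm_nonneg _) (norm_mehlerWeight_le_one P ξ p.2)).trans ?_
  have e : (expSum α κ U p.1) = ((expSum α κ U p.1).re : ℂ) := by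
    apply Complex.ext <;> simp [hreal]
  rw [norm_mul, norm_mul, norm_mul, norm_mul, Complex.norm_I, one_mul, mul_one, e,
    mul_right_comm, ← Complex.ofReal_mul, Complex.norm_exp_ofReal_mul_I, mul_one, mul_comm,
    Complex.norm_real]
  exact mul_le_mul_of_nonneg_left (norm_expSumDeriv_le _) (norm_nonneg _)

end

section
variable {Ω A : Type*} [MeasurableSpace Ω] [MeasurableSpace A]
variable {P : Measure Ω} [IsProbabilityMeasure P] {V : Submodule ℝ (Ω → ℝ)} {α : Measure A}
  [IsFiniteMeasure α] {κ : A → ℂ} {U : A × Ω → ℝ} {C D : ℝ} {ξ η : Ω → ℝ}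

/-- A bound for the covariance of `exp (i ξ)` with Lipschitz functions of `expSum α κ U`. -/
noncomputable def covNorm (P : Measure Ω) (α : Measure A) (κ : A → ℂ) (U : A × Ω → ℝ)
    (ξ : Ω → ℝ) : ℝ :=
  ∫ a, ‖κ a‖ * |mixedMoment P ξ (fun ω => U (a, ω))| ∂α

lemma IsExpFamily.integrable_covNorm (h : IsExpFamily P V κ U C) (hξ : ξ ∈ V) :
    Integrable (fun a => ‖κ a‖ * |mixedMoment P ξ (fun ω => U (a, ω))|) α := by
  have mκ := h.measurable_coeff
  have mc := h.measurable_mixedMoment hξ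
  refine Integrable.of_bound (by fun_prop) (C * (mixedMoment P ξ ξ + C)) (ae_of_all _ fun a => ?_)
  rw [norm_mul, norm_norm, norm_abs_eq_norm]
  exact mul_le_mul (h.norm_coeff_le a) (h.abs_mixedMoment_le hξ a) (norm_nonneg _) (h.nonneg a)

lemma IsExpFamily.covNorm_smul_add_le (h : IsExpFamily P V κ U C) (hξ : ξ ∈ V) (hη : η ∈ V)
    {s : ℝ} (hs : s ∈ Ioc (0 : ℝ) 1) :
    covNorm P α κ U (s • ξ + η) ≤ covNorm P α κ U ξ + covNorm P α κ U η := by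
  rw [covNorm, covNorm, covNorm, ← integral_add (h.integrable_covNorm hξ) (h.integrable_covNorm hη)]
  refine integral_mono (h.integrable_covNorm (V.add_mem (V.smul_mem s hξ) hη))
    ((h.integrable_covNorm hξ).add (h.integrable_covNorm hη)) fun a => ?_
  have e : mixedMoment P (s • ξ + η) (fun ω => U (a, ω))
      = s * mixedMoment P ξ (fun ω => U (a, ω)) + mixedMoment P η (fun ω => U (a, ω)) := by
    simp only [mixedMoment, Pi.add_apply, Pi.smul_apply, smul_eq_mul, add_mul, mul_assoc]
    rw [integral_add ((h.gaussian.integrable_mul hξ (h.mem a)).const_mul s)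
      (h.gaussian.integrable_mul hη (h.mem a)), integral_const_mul]
  beta_reduce
  rw [e, ← mul_add]
  refine mul_le_mul_of_nonneg_left ((abs_add_le _ _).trans ?_) (norm_nonneg _)
  rw [abs_mul, abs_of_pos hs.1]
  gcongr
  exact mul_le_of_le_one_left (abs_nonneg _) hs.2

lemma IsExpFamily.norm_cexp_expSum (hreal : ∀ ω, (expSum α κ U ω).im = 0) (t : ℝ) (ω : Ω) :
    ‖Complex.exp (t * Complex.I * expSum α κ U ω)‖ = 1 := by
  have e : (expSum α κ U ω) = ((expSum α κ U ω).re : ℂ) := by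
    apply Complex.ext <;> simp [hreal]
  rw [e, mul_right_comm, ← Complex.ofReal_mul, Complex.norm_exp_ofReal_mul_I]

lemma IsExpFamily.integrable_cexp_expSum (h : IsExpFamily P V κ U C)
    (hreal : ∀ ω, (expSum α κ U ω).im = 0) (t : ℝ) :
    Integrable (fun ω => Complex.exp (t * Complex.I * expSum α κ U ω)) P := by
  have mZ := h.measurable_expSum (α := α)
  exact Integrable.of_bound (by fun_prop) 1
    (ae_of_all _ fun ω => (IsExpFamily.norm_cexp_expSum hreal t ω).le)

lemma IsExpFamily.norm_cexp_mul_sub_le (h : IsExpFamily P V κ U C)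
    (hreal : ∀ ω, (expSum α κ U ω).im = 0) (hξ : ξ ∈ V) (t : ℝ) :
    ‖∫ ω, Complex.exp (ξ ω * Complex.I) * (Complex.exp (t * Complex.I * expSum α κ U ω)
        - ∫ ω, Complex.exp (t * Complex.I * expSum α κ U ω) ∂P) ∂P‖
      ≤ |t| * covNorm P α κ U ξ := by
  refine (le_of_eq (congrArg norm ?_)).trans (h.norm_cov_cexp_le hreal hξ t)
  have mξ := h.gaussian.measurable ξ hξ
  have mZ := h.measurable_expSum (α := α)
  have i1 : Integrable (fun ω => Complex.exp (ξ ω * Complex.I)) P :=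
    Integrable.of_bound (by fun_prop) 1 (ae_of_all _ fun ω => by
      simp [Complex.norm_exp_ofReal_mul_I])
  have i2 := h.integrable_cexp_expSum hreal t
  have i3 : Integrable (fun ω => Complex.exp (ξ ω * Complex.I)
      * Complex.exp (t * Complex.I * expSum α κ U ω)) P :=
    Integrable.of_bound (by fun_prop) 1 (ae_of_all _ fun ω => by
      rw [norm_mul, IsExpFamily.norm_cexp_expSum hreal, Complex.norm_exp_ofReal_mul_I, one_mul])
  simp only [mul_sub, sub_mul]
  rw [integral_sub i3 (i1.mul_const _), integral_sub i3 (i2.const_mul _), integral_mul_const,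
    integral_const_mul]

lemma IsExpFamily.norm_second_order_le (h : IsExpFamily P V κ U C)
    (hreal : ∀ ω, (expSum α κ U ω).im = 0)
    (hD : ∀ a, covNorm P α κ U (fun ω => U (a, ω)) ≤ D) (hξ : ξ ∈ V)
    (hξD : covNorm P α κ U ξ ≤ D) (t : ℝ) :
    ‖∫ p, mehlerWeight P ξ p.2 * Complex.exp (p.2 * ξ p.1 * Complex.I)
        * (Complex.I * expSumDeriv P α κ U ξ p.1 *
          (Complex.exp (t * Complex.I * expSum α κ U p.1)
            - ∫ ω, Complex.exp (t * Complex.I * expSum α κ U ω) ∂P))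
        ∂(P.prod (volume.restrict (Set.Ioc (0 : ℝ) 1)))‖ ≤ 2 * D ^ 2 * |t| := by
  have mξ := h.gaussian.measurable ξ hξ
  have mU := h.measurable
  have mκ := h.measurable_coeff
  have mZ := h.measurable_expSum (α := α)
  have mD := h.measurable_expSumDeriv (α := α) hξ
  have mw := (continuous_mehlerWeight P ξ).measurable
  have mc := h.measurable_mixedMoment hξ
  obtain ⟨M, hM⟩ : ∃ M, ∀ ω, ‖expSumDeriv P α κ U ξ ω‖ ≤ M := ⟨_, norm_expSumDeriv_le⟩
  have hce : ∀ x : ℝ, ‖Complex.exp (x * Complex.I)‖ = 1 := Complex.norm_exp_ofReal_mul_I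
  have hcZ := IsExpFamily.norm_cexp_expSum hreal t
  set φ := ∫ ω, Complex.exp (t * Complex.I * expSum α κ U ω) ∂P with hφ
  have hφ1 : ‖φ‖ ≤ 1 := by
    refine (norm_integral_le_of_norm_le_const (ae_of_all _ fun ω => (hcZ ω).le)).trans ?_
    simp
  have hH : ∀ ω, ‖Complex.exp (t * Complex.I * expSum α κ U ω) - φ‖ ≤ 2 := fun ω =>
    (norm_sub_le _ _).trans (by rw [hcZ]; linarith)
  have hM0 : 0 ≤ M := by
    obtain ⟨ω⟩ := nonempty_of_isProbabilityMeasure P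
    exact (norm_nonneg _).trans (hM ω)
  rw [integral_prod_symm]
  swap
  · refine Integrable.of_bound (by fun_prop) (M * 2) (ae_of_all _ fun p => ?_)
    rw [norm_mul, norm_mul, ← Complex.ofReal_mul, hce, mul_one]
    refine (mul_le_of_le_one_left (norm_nonneg _) (norm_mehlerWeight_le_one P ξ p.2)).trans ?_
    rw [norm_mul, norm_mul, Complex.norm_I, one_mul]
    exact mul_le_mul (hM _) (hH _) (norm_nonneg _) hM0
  refine (norm_setIntegral_le_of_norm_le_const (C := 2 * D ^ 2 * |t|) (by simp)
    fun s hs => ?_).trans_eq (by simp)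
  have e1 : ∀ ω, mehlerWeight P ξ s * Complex.exp (s * ξ ω * Complex.I)
        * (Complex.I * expSumDeriv P α κ U ξ ω *
          (Complex.exp (t * Complex.I * expSum α κ U ω) - φ))
      = ∫ a, -(mehlerWeight P ξ s * (κ a * mixedMoment P ξ (fun ω => U (a, ω))))
        * (Complex.exp ((s • ξ + fun ω => U (a, ω)) ω * Complex.I) *
          (Complex.exp (t * Complex.I * expSum α κ U ω) - φ)) ∂α := by
    intro ω
    have : ∀ x y z : ℂ, x * (Complex.I * (Complex.I * y) * z) = (-x * z) * y := by
      intro x y z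
      linear_combination (x * y * z) * Complex.I_mul_I
    rw [expSumDeriv, this, ← integral_const_mul]
    refine integral_congr_ae (ae_of_all _ fun a => ?_)
    simp only [Pi.add_apply, Pi.smul_apply, smul_eq_mul]
    push_cast
    rw [add_mul, Complex.exp_add]
    ring
  simp only [e1]
  rw [integral_integral_swap_of_norm_le (B := C * (mixedMoment P ξ ξ + C) * 2)]
  · simp only [integral_const_mul]
    refine (norm_integral_le_integral_norm _).trans ?_
    have : ∀ a, ‖-(mehlerWeight P ξ s * (κ a * mixedMoment P ξ (fun ω => U (a, ω))))
        * ∫ ω, Complex.exp ((s • ξ + fun ω => U (a, ω)) ω * Complex.I) *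
          (Complex.exp (t * Complex.I * expSum α κ U ω) - φ) ∂P‖
        ≤ (‖κ a‖ * |mixedMoment P ξ (fun ω => U (a, ω))|) * (|t| * (D + D)) := by
      intro a
      rw [norm_mul, norm_neg, norm_mul, norm_mul (κ a), Complex.norm_real (mixedMoment _ _ _)]
      have h1 := h.norm_cexp_mul_sub_le hreal (V.add_mem (V.smul_mem s hξ) (h.mem a)) t
      have h2 := h.covNorm_smul_add_le (α := α) hξ (h.mem a) hs
      have h3 := hD a
      refine mul_le_mul (mul_le_of_le_one_left (by positivity) (norm_mehlerWeight_le_one P ξ s))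
        (h1.trans ?_) (norm_nonneg _) (by positivity)
      gcongr
      linarith
    refine (integral_mono_of_nonneg (ae_of_all _ fun a => norm_nonneg _)
      ((h.integrable_covNorm hξ).mul_const _) (ae_of_all _ this)).trans ?_
    rw [integral_mul_const]
    have h0 : 0 ≤ covNorm P α κ U ξ := integral_nonneg fun a => by positivity
    have hD0 : 0 ≤ D := h0.trans hξD
    calc _ ≤ D * (|t| * (D + D)) := mul_le_mul_of_nonneg_right hξD (by positivity)
      _ = _ := by ring
  · simp only [Function.uncurry_def, Pi.add_apply, Pi.smul_apply, smul_eq_mul]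
    have mc' : Measurable (fun q : Ω × A => mixedMoment P ξ (fun ω => U (q.2, ω))) :=
      mc.comp measurable_snd
    fun_prop
  · intro ω a
    rw [norm_mul, norm_neg, norm_mul, norm_mul, norm_mul, hce, one_mul]
    have := h.abs_mixedMoment_le hξ a
    refine mul_le_mul ((mul_le_of_le_one_left (by positivity)
      (norm_mehlerWeight_le_one P ξ s)).trans ?_) (hH ω) (norm_nonneg _)
      (mul_nonneg (h.nonneg a) ((abs_nonneg _).trans this))
    rw [Complex.norm_real]
    exact mul_le_mul (h.norm_coeff_le a) this (norm_nonneg _) (h.nonneg a)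

/-- Centred superpositions may be integrated termwise after centring each exponential. -/
lemma IsExpFamily.integral_expSum_mul (h : IsExpFamily P V κ U C)
    (hmean : ∫ ω, expSum α κ U ω ∂P = 0) {H : Ω → ℂ} (mH : Measurable H) {B : ℝ}
    (hB : ∀ ω, ‖H ω‖ ≤ B) :
    ∫ ω, expSum α κ U ω * H ω ∂P
      = ∫ a, κ a * ∫ ω, (Complex.exp (U (a, ω) * Complex.I)
          - ∫ ω, Complex.exp (U (a, ω) * Complex.I) ∂P) * H ω ∂P ∂α := by
  have mU := h.measurable
  have mκ := h.measurable_coeff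
  have hce : ∀ x : ℝ, ‖Complex.exp (x * Complex.I)‖ = 1 := Complex.norm_exp_ofReal_mul_I
  have swap : ∀ G : Ω → ℂ, Measurable G → ∀ B' : ℝ, (∀ ω, ‖G ω‖ ≤ B') →
      ∫ ω, expSum α κ U ω * G ω ∂P
        = ∫ a, κ a * ∫ ω, Complex.exp (U (a, ω) * Complex.I) * G ω ∂P ∂α := by
    intro G mG B' hB'
    simp only [expSum, ← integral_mul_const, ← integral_const_mul]
    rw [integral_integral_swap_of_norm_le (B := C * B')]
    · simp only [mul_assoc]
    · simp only [Function.uncurry_def]; fun_prop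
    · intro ω a
      rw [norm_mul, norm_mul, hce, mul_one]
      exact mul_le_mul (h.norm_coeff_le a) (hB' ω) (norm_nonneg _) (h.nonneg a)
  have h1 := swap (fun _ => 1) measurable_const 1 (by simp)
  simp only [mul_one, hmean] at h1
  have mm : Measurable (fun a => ∫ ω, Complex.exp (U (a, ω) * Complex.I) ∂P) :=
    (StronglyMeasurable.integral_prod_right'
      (f := fun p : A × Ω => Complex.exp (U p * Complex.I))
      (by fun_prop : Measurable _).stronglyMeasurable).measurable
  have mm2 : Measurable (fun a => ∫ ω, Complex.exp (U (a, ω) * Complex.I) * H ω ∂P) :=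
    (StronglyMeasurable.integral_prod_right'
      (f := fun p : A × Ω => Complex.exp (U p * Complex.I) * H p.2)
      (by fun_prop : Measurable _).stronglyMeasurable).measurable
  have iH : Integrable H P := Integrable.of_bound mH.aestronglyMeasurable B (ae_of_all _ hB)
  have iUH : ∀ a, Integrable (fun ω => Complex.exp (U (a, ω) * Complex.I) * H ω) P := fun a =>
    Integrable.of_bound (by fun_prop) B (ae_of_all _ fun ω => by
      rw [norm_mul, hce, one_mul]; exact hB ω)
  have i1 : Integrable (fun a => κ a * ∫ ω, Complex.exp (U (a, ω) * Complex.I) ∂P) α :=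
    Integrable.of_bound (by fun_prop) (C * 1) (ae_of_all _ fun a => by
      rw [norm_mul]
      exact mul_le_mul (h.norm_coeff_le a) (norm_integral_cexp_le_one P _) (norm_nonneg _)
        (h.nonneg a))
  have i2 : Integrable (fun a => κ a * ∫ ω, Complex.exp (U (a, ω) * Complex.I) * H ω ∂P) α :=
    Integrable.of_bound (by fun_prop) (C * B) (ae_of_all _ fun a => by
      rw [norm_mul]
      refine mul_le_mul (h.norm_coeff_le a) ?_ (norm_nonneg _) (h.nonneg a)
      refine (norm_integral_le_of_norm_le_const (ae_of_all _ fun ω => ?_)).trans_eq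
        (by simp : B * _ = B)
      rw [norm_mul, hce, one_mul]; exact hB ω)
  have e : ∀ a, κ a * ∫ ω, (Complex.exp (U (a, ω) * Complex.I)
          - ∫ ω, Complex.exp (U (a, ω) * Complex.I) ∂P) * H ω ∂P
      = κ a * (∫ ω, Complex.exp (U (a, ω) * Complex.I) * H ω ∂P)
        - κ a * (∫ ω, Complex.exp (U (a, ω) * Complex.I) ∂P) * ∫ ω, H ω ∂P := by
    intro a
    simp only [sub_mul]
    rw [integral_sub (iUH a) (iH.const_mul _), integral_const_mul]
    ring
  simp only [e]
  rw [integral_sub i2 (i1.mul_const _), integral_mul_const, ← h1, zero_mul, sub_zero,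
    swap H mH B hB]

end

/-- A function nearly solving `φ' = -t s φ` is close to the Gaussian `exp (-s t² / 2)`. -/
lemma norm_sub_exp_le_of_deriv {φ φ' : ℝ → ℂ} (hφ : ∀ t, HasDerivAt φ (φ' t) t) (h0 : φ 0 = 1)
    {s B t₀ : ℝ} (hs : 0 ≤ s) (ht₀ : 0 ≤ t₀)
    (hB : ∀ t ∈ Icc 0 t₀, ‖φ' t + t * s * φ t‖ ≤ B) :
    ‖φ t₀ - Real.exp (-(s * t₀ ^ 2) / 2)‖ ≤ B * t₀ := by
  have hB0 : 0 ≤ B := (norm_nonneg _).trans (hB 0 ⟨le_rfl, ht₀⟩)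
  have he : ∀ t, HasDerivAt (fun t : ℝ => ((Real.exp (s * t ^ 2 / 2) : ℝ) : ℂ))
      (((Real.exp (s * t ^ 2 / 2) * (s * t) : ℝ)) : ℂ) t := by
    intro t
    have := ((((hasDerivAt_id t).pow 2).const_mul s).div_const 2).exp.ofReal_comp
    refine (this.congr_deriv ?_).congr_of_eventuallyEq (Eventually.of_forall fun x => ?_)
    · congr 2
      simp
      ring
    · simp
  have hm : ∀ t, HasDerivAt (fun t => φ t * ((Real.exp (s * t ^ 2 / 2) : ℝ) : ℂ))
      ((φ' t + t * s * φ t) * ((Real.exp (s * t ^ 2 / 2) : ℝ) : ℂ)) t := fun t =>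
    ((hφ t).mul (he t)).congr_deriv (by push_cast; ring)
  have key := norm_image_sub_le_of_norm_deriv_le_segment' (a := 0) (b := t₀)
    (C := B * Real.exp (s * t₀ ^ 2 / 2))
    (fun t _ => (hm t).hasDerivWithinAt) (fun t ht => by
      rw [norm_mul, Complex.norm_real, Real.norm_of_nonneg (Real.exp_nonneg _)]
      gcongr
      · exact hB t ⟨ht.1, ht.2.le⟩
      · exact ht.1
      · exact ht.2.le) t₀ ⟨ht₀, le_rfl⟩
  have e : φ t₀ - Real.exp (-(s * t₀ ^ 2) / 2)
      = (φ t₀ * ((Real.exp (s * t₀ ^ 2 / 2) : ℝ) : ℂ)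
          - φ 0 * ((Real.exp (s * 0 ^ 2 / 2) : ℝ) : ℂ)) * (Real.exp (-(s * t₀ ^ 2 / 2)) : ℝ) := by
    rw [h0, sub_mul, mul_assoc, ← Complex.ofReal_mul, ← Real.exp_add]
    simp [neg_div]
  rw [e, norm_mul, Complex.norm_real, Real.norm_of_nonneg (Real.exp_nonneg _)]
  calc _ ≤ B * Real.exp (s * t₀ ^ 2 / 2) * (t₀ - 0) * Real.exp (-(s * t₀ ^ 2 / 2)) := by gcongr
    _ = B * t₀ * (Real.exp (s * t₀ ^ 2 / 2) * Real.exp (-(s * t₀ ^ 2 / 2))) := by ring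
    _ = _ := by rw [← Real.exp_add]; simp

section
variable {Ω A : Type*} [MeasurableSpace Ω] [MeasurableSpace A]
variable {P : Measure Ω} [IsProbabilityMeasure P] {V : Submodule ℝ (Ω → ℝ)} {α : Measure A}
  [IsFiniteMeasure α] {κ : A → ℂ} {U : A × Ω → ℝ} {C D : ℝ}

lemma IsExpFamily.norm_stein_le (h : IsExpFamily P V κ U C)
    (hreal : ∀ ω, (expSum α κ U ω).im = 0)
    (hD : ∀ a, covNorm P α κ U (fun ω => U (a, ω)) ≤ D)
    (hmean : ∫ ω, expSum α κ U ω ∂P = 0) (t : ℝ) :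
    ‖∫ ω, expSum α κ U ω * (Complex.exp (t * Complex.I * expSum α κ U ω)
        - t * Complex.I * (∫ ω, Complex.exp (t * Complex.I * expSum α κ U ω) ∂P)
          * expSum α κ U ω) ∂P‖ ≤ 2 * D ^ 2 * t ^ 2 * (C * α.real univ) := by
  have mU := h.measurable
  have mZ := h.measurable_expSum (α := α)
  have hZ := h.norm_expSum_le (α := α)
  have hce : ∀ x : ℝ, ‖Complex.exp (x * Complex.I)‖ = 1 := Complex.norm_exp_ofReal_mul_I
  have hcZ := IsExpFamily.norm_cexp_expSum hreal t
  set φ := ∫ ω, Complex.exp (t * Complex.I * expSum α κ U ω) ∂P with hφ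
  rw [h.integral_expSum_mul hmean (by fun_prop)
    (B := 1 + ‖t * Complex.I * φ‖ * (C * α.real univ)) fun ω => by
      refine (norm_sub_le _ _).trans ?_
      rw [hcZ, norm_mul]
      gcongr
      exact hZ ω]
  refine (norm_integral_le_of_norm_le_const (C := 2 * D ^ 2 * t ^ 2 * C)
    (ae_of_all _ fun a => ?_)).trans_eq (by ring)
  have hξ := h.mem a
  have mξ := h.gaussian.measurable _ hξ
  have mD := h.measurable_expSumDeriv (α := α) hξ
  have mw := (continuous_mehlerWeight P (fun ω => U (a, ω))).measurable
  set m := ∫ ω, Complex.exp (U (a, ω) * Complex.I) ∂P with hm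
  have hm1 : ‖m‖ ≤ 1 := norm_integral_cexp_le_one P _
  obtain ⟨M, hM⟩ : ∃ M, ∀ ω, ‖expSumDeriv P α κ U (fun ω => U (a, ω)) ω‖ ≤ M :=
    ⟨_, norm_expSumDeriv_le⟩
  have b2 : ∀ ω, ‖Complex.exp (U (a, ω) * Complex.I) - m‖ ≤ 2 := fun ω =>
    (norm_sub_le _ _).trans (by rw [hce]; linarith)
  have i1 : Integrable (fun ω => (Complex.exp (U (a, ω) * Complex.I) - m)
      * Complex.exp (t * Complex.I * expSum α κ U ω)) P :=
    Integrable.of_bound (by fun_prop) 2 (ae_of_all _ fun ω => by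
      rw [norm_mul, hcZ, mul_one]; exact b2 ω)
  have i2 : Integrable (fun ω => (Complex.exp (U (a, ω) * Complex.I) - m)
      * expSum α κ U ω) P :=
    Integrable.of_bound (by fun_prop) (2 * (C * α.real univ)) (ae_of_all _ fun ω => by
      rw [norm_mul]; exact mul_le_mul (b2 ω) (hZ ω) (norm_nonneg _) (by norm_num))
  let W : Ω × ℝ → ℂ := fun p => mehlerWeight P (fun ω => U (a, ω)) p.2
    * Complex.exp (p.2 * U (a, p.1) * Complex.I)
    * (Complex.I * expSumDeriv P α κ U (fun ω => U (a, ω)) p.1)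
  have mW : Measurable W := by fun_prop
  have hW : ∀ p, ‖W p‖ ≤ M := by
    intro p
    simp only [W]
    rw [norm_mul, norm_mul, ← Complex.ofReal_mul, hce, mul_one]
    refine (mul_le_of_le_one_left (norm_nonneg _) (norm_mehlerWeight_le_one P _ p.2)).trans ?_
    rw [norm_mul, Complex.norm_I, one_mul]
    exact hM _
  let ν := P.prod (volume.restrict (Set.Ioc (0 : ℝ) 1))
  have j1 : Integrable (fun p => W p * Complex.exp (t * Complex.I * expSum α κ U p.1)) ν :=
    Integrable.of_bound (by fun_prop) M (ae_of_all _ fun p => by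
      rw [norm_mul, hcZ, mul_one]; exact hW p)
  have j2 : Integrable W ν := Integrable.of_bound (by fun_prop) M (ae_of_all _ hW)
  have k1 : ∫ ω, (Complex.exp (U (a, ω) * Complex.I) - m)
      * Complex.exp (t * Complex.I * expSum α κ U ω) ∂P
      = t * Complex.I * ∫ p, W p * Complex.exp (t * Complex.I * expSum α κ U p.1) ∂ν := by
    rw [h.integral_cexp_sub_mul_cexp hξ, ← integral_const_mul]
    refine integral_congr_ae (ae_of_all _ fun p => ?_)
    simp only [W]; ring
  have k2 : ∫ ω, (Complex.exp (U (a, ω) * Complex.I) - m) * expSum α κ U ω ∂P = ∫ p, W p ∂ν := by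
    rw [h.integral_cexp_sub_mul_expSum hξ]
    simp only [W, mul_one, ν]
  have key : ∫ ω, (Complex.exp (U (a, ω) * Complex.I) - m)
      * (Complex.exp (t * Complex.I * expSum α κ U ω) - t * Complex.I * φ * expSum α κ U ω) ∂P
      = t * Complex.I * ∫ p, mehlerWeight P (fun ω => U (a, ω)) p.2
        * Complex.exp (p.2 * U (a, p.1) * Complex.I)
        * (Complex.I * expSumDeriv P α κ U (fun ω => U (a, ω)) p.1 *
          (Complex.exp (t * Complex.I * expSum α κ U p.1) - φ))
        ∂(P.prod (volume.restrict (Set.Ioc (0 : ℝ) 1))) := by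
    have e1 : ∀ ω, (Complex.exp (U (a, ω) * Complex.I) - m)
      * (Complex.exp (t * Complex.I * expSum α κ U ω) - t * Complex.I * φ * expSum α κ U ω)
      = (Complex.exp (U (a, ω) * Complex.I) - m) * Complex.exp (t * Complex.I * expSum α κ U ω)
        - t * Complex.I * φ * ((Complex.exp (U (a, ω) * Complex.I) - m) * expSum α κ U ω) :=
      fun ω => by ring
    simp only [e1]
    have e2 : ∀ p : Ω × ℝ, mehlerWeight P (fun ω => U (a, ω)) p.2
        * Complex.exp (p.2 * U (a, p.1) * Complex.I)
        * (Complex.I * expSumDeriv P α κ U (fun ω => U (a, ω)) p.1 *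
          (Complex.exp (t * Complex.I * expSum α κ U p.1) - φ))
        = W p * Complex.exp (t * Complex.I * expSum α κ U p.1) - W p * φ := by
      intro p; simp only [W]; ring
    simp only [e2]
    rw [integral_sub i1 (i2.const_mul _), integral_const_mul, k1, k2,
      integral_sub j1 (j2.mul_const _), integral_mul_const]
    ring
  rw [key, norm_mul, norm_mul]
  have h1 := h.norm_second_order_le hreal hD hξ (hD a) t
  have h2 : ‖(t : ℂ) * Complex.I‖ = |t| := by simp
  rw [h2]
  calc _ ≤ C * (|t| * (2 * D ^ 2 * |t|)) := by
        gcongr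
        · exact h.nonneg a
        · exact h.norm_coeff_le a
    _ = _ := by rw [← sq_abs t]; ring

/-- Quantitative central limit theorem for superpositions of exponentials of a Gaussian process. -/
theorem IsExpFamily.norm_charFun_sub_le (h : IsExpFamily P V κ U C)
    (hreal : ∀ ω, (expSum α κ U ω).im = 0)
    (hD : ∀ a, covNorm P α κ U (fun ω => U (a, ω)) ≤ D)
    (hmean : ∫ ω, expSum α κ U ω ∂P = 0) {t : ℝ} (ht : 0 ≤ t) :
    ‖∫ ω, Complex.exp (t * Complex.I * expSum α κ U ω) ∂P
        - Real.exp (-((∫ ω, (expSum α κ U ω).re ^ 2 ∂P) * t ^ 2) / 2)‖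
      ≤ 2 * D ^ 2 * (C * α.real univ) * t ^ 3 := by
  have mZ := h.measurable_expSum (α := α)
  have hZ := h.norm_expSum_le (α := α)
  have hderiv : ∀ t : ℝ, HasDerivAt
      (fun t : ℝ => ∫ ω, Complex.exp (t * Complex.I * expSum α κ U ω) ∂P)
      (∫ ω, Complex.I * expSum α κ U ω * Complex.exp (t * Complex.I * expSum α κ U ω) ∂P) t := by
    intro t
    refine (hasDerivAt_integral_of_dominated_loc_of_deriv_le (s := univ)
      (F := fun (t : ℝ) ω => Complex.exp (t * Complex.I * expSum α κ U ω))
      (F' := fun (t : ℝ) ω =>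
        Complex.I * expSum α κ U ω * Complex.exp (t * Complex.I * expSum α κ U ω))
      (bound := fun _ => C * α.real univ) univ_mem
      (Eventually.of_forall fun t => by fun_prop) (h.integrable_cexp_expSum hreal t) (by fun_prop)
      ?_ (integrable_const _) ?_).2
    · refine ae_of_all _ fun ω t _ => ?_
      rw [norm_mul, norm_mul, IsExpFamily.norm_cexp_expSum hreal, Complex.norm_I, one_mul, mul_one]
      exact hZ ω
    · refine ae_of_all _ fun ω t _ => ?_
      have := (((Complex.ofRealCLM.hasDerivAt (x := t)).mul_const
        (Complex.I * expSum α κ U ω))).cexp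
      refine (this.congr_deriv ?_).congr_of_eventuallyEq (Eventually.of_forall fun x => ?_)
      · simp; ring_nf
      · simp [mul_assoc]
  have hsq : (∫ ω, expSum α κ U ω * expSum α κ U ω ∂P)
      = ((∫ ω, (expSum α κ U ω).re ^ 2 ∂P : ℝ) : ℂ) := by
    rw [← integral_complex_ofReal]
    refine integral_congr_ae (ae_of_all _ fun ω => ?_)
    have e : (expSum α κ U ω) = ((expSum α κ U ω).re : ℂ) := by
      apply Complex.ext <;> simp [hreal]
    beta_reduce
    rw [e]; simp; ring
  refine (norm_sub_exp_le_of_deriv (B := 2 * D ^ 2 * t ^ 2 * (C * α.real univ)) hderiv (by simp)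
    (integral_nonneg fun ω => sq_nonneg _) ht fun u hu => ?_).trans_eq (by ring)
  have i1 : Integrable (fun ω => expSum α κ U ω
      * Complex.exp (u * Complex.I * expSum α κ U ω)) P :=
    Integrable.of_bound (by fun_prop) (C * α.real univ) (ae_of_all _ fun ω => by
      rw [norm_mul, IsExpFamily.norm_cexp_expSum hreal, mul_one]; exact hZ ω)
  have i2 : Integrable (fun ω => expSum α κ U ω * expSum α κ U ω) P :=
    Integrable.of_bound (by fun_prop) (C * α.real univ * (C * α.real univ))
      (ae_of_all _ fun ω => by
        rw [norm_mul]
        exact mul_le_mul (hZ ω) (hZ ω) (norm_nonneg _) ((norm_nonneg _).trans (hZ ω)))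
  have e : (∫ ω, Complex.I * expSum α κ U ω * Complex.exp (u * Complex.I * expSum α κ U ω) ∂P)
      + u * (∫ ω, (expSum α κ U ω).re ^ 2 ∂P : ℝ)
        * ∫ ω, Complex.exp (u * Complex.I * expSum α κ U ω) ∂P
      = Complex.I * ∫ ω, expSum α κ U ω * (Complex.exp (u * Complex.I * expSum α κ U ω)
        - u * Complex.I * (∫ ω, Complex.exp (u * Complex.I * expSum α κ U ω) ∂P)
          * expSum α κ U ω) ∂P := by
    have e1 : ∀ ω, expSum α κ U ω * (Complex.exp (u * Complex.I * expSum α κ U ω)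
        - u * Complex.I * (∫ ω, Complex.exp (u * Complex.I * expSum α κ U ω) ∂P)
          * expSum α κ U ω)
        = expSum α κ U ω * Complex.exp (u * Complex.I * expSum α κ U ω)
          - u * Complex.I * (∫ ω, Complex.exp (u * Complex.I * expSum α κ U ω) ∂P)
            * (expSum α κ U ω * expSum α κ U ω) := fun ω => by ring
    simp only [e1]
    rw [integral_sub i1 (i2.const_mul _), integral_const_mul, hsq]
    simp only [mul_assoc, integral_const_mul]
    linear_combination ((u : ℂ) * (∫ ω, (expSum α κ U ω).re ^ 2 ∂P : ℝ)
        * ∫ ω, Complex.exp (u * (Complex.I * expSum α κ U ω)) ∂P) * Complex.I_mul_I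
  rw [e, norm_mul, Complex.norm_I, one_mul]
  refine (h.norm_stein_le hreal hD hmean u).trans ?_
  obtain ⟨ω⟩ := nonempty_of_isProbabilityMeasure P
  have := (norm_nonneg _).trans (hZ ω)
  have := hu.1
  have := hu.2
  gcongr

end

/-- A jointly measurable, centered stationary Gaussian process on `[0, ∞)` with unit variance and
covariance function `r`. -/
structure IsStationaryGaussian {Ω : Type*} [MeasurableSpace Ω] (P : Measure Ω)
    (Y : ℝ → Ω → ℝ) (r : ℝ → ℝ) : Prop where
  measurable : Measurable (Function.uncurry Y)
  even : ∀ t, r (-t) = r t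
  apply_zero : r 0 = 1
  map_eq : ∀ (k : ℕ) (t c : Fin k → ℝ), (∀ i, 0 ≤ t i) →
      P.map (fun ω => ∑ i, c i * Y (t i) ω)
        = gaussianReal 0 (Real.toNNReal (∑ i, ∑ j, c i * c j * r (t i - t j)))

namespace IsStationaryGaussian

variable {Ω : Type*} [MeasurableSpace Ω] {P : Measure Ω} {Y : ℝ → Ω → ℝ} {r : ℝ → ℝ}

lemma measurable_apply (hY : IsStationaryGaussian P Y r) (t : ℝ) : Measurable (Y t) :=
  hY.measurable.of_uncurry_left

lemma isGaussianSpace (hY : IsStationaryGaussian P Y r) :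
    IsGaussianSpace P (Submodule.span ℝ (Y '' Ici 0)) := by
  have key : ∀ ξ ∈ Submodule.span ℝ (Y '' Ici 0), ∃ (k : ℕ) (t c : Fin k → ℝ), (∀ i, 0 ≤ t i) ∧
      ξ = fun ω => ∑ i, c i * Y (t i) ω := by
    intro ξ hξ
    obtain ⟨n, c, g, rfl⟩ := Submodule.mem_span_set'.1 hξ
    choose t ht htg using fun i => (g i).2
    refine ⟨n, t, c, ht, ?_⟩
    ext ω
    simp [htg]
  refine ⟨fun ξ hξ => ?_, fun ξ hξ => ?_⟩ <;> obtain ⟨k, t, c, ht, rfl⟩ := key ξ hξ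
  · have := hY.measurable_apply
    fun_prop
  · exact ⟨_, hY.map_eq k t c ht⟩

lemma mem (_hY : IsStationaryGaussian P Y r) {t : ℝ} (ht : 0 ≤ t) :
    Y t ∈ Submodule.span ℝ (Y '' Ici 0) :=
  Submodule.subset_span ⟨t, ht, rfl⟩

lemma map_apply (hY : IsStationaryGaussian P Y r) {t : ℝ} (ht : 0 ≤ t) :
    P.map (Y t) = gaussianReal 0 1 := by
  simpa [hY.apply_zero] using hY.map_eq 1 (fun _ => t) (fun _ => 1) (fun _ => ht)

lemma measurePreserving (hY : IsStationaryGaussian P Y r) {t : ℝ} (ht : 0 ≤ t) :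
    MeasurePreserving (Y t) P (gaussianReal 0 1) :=
  ⟨hY.measurable_apply t, hY.map_apply ht⟩

lemma mixedMoment_self (hY : IsStationaryGaussian P Y r) {t : ℝ} (ht : 0 ≤ t) :
    mixedMoment P (Y t) (Y t) = 1 := by
  have h0 : 0 ≤ mixedMoment P (Y t) (Y t) := integral_nonneg fun ω => mul_self_nonneg _
  have h1 := hY.isGaussianSpace.map_eq_mixedMoment (hY.mem ht)
  rw [hY.map_apply ht, gaussianReal_ext_iff] at h1
  have := congrArg NNReal.toReal h1.2
  rw [Real.coe_toNNReal _ h0] at this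
  simpa using this.symm

lemma mixedMoment_eq (hY : IsStationaryGaussian P Y r) {s t : ℝ} (hs : 0 ≤ s) (ht : 0 ≤ t) :
    mixedMoment P (Y s) (Y t) = r (s - t) := by
  have key : ∀ c : ℝ, c ^ 2 + 2 * c * mixedMoment P (Y s) (Y t) + 1
      = max (c ^ 2 + 2 * c * r (s - t) + 1) 0 := by
    intro c
    have hm := Submodule.add_mem _ (Submodule.smul_mem _ c (hY.mem hs)) (hY.mem ht)
    have h0 : 0 ≤ mixedMoment P (c • Y s + Y t) (c • Y s + Y t) :=
      integral_nonneg fun ω => mul_self_nonneg _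
    have h1 := hY.isGaussianSpace.map_eq_mixedMoment hm
    have h2 := hY.map_eq 2 ![s, t] ![c, 1] (by intro i; fin_cases i <;> simpa)
    have e : (fun ω => ∑ i, (![c, 1] : Fin 2 → ℝ) i * Y ((![s, t] : Fin 2 → ℝ) i) ω)
        = c • Y s + Y t := by ext ω; simp
    rw [e, h1, gaussianReal_ext_iff] at h2
    have h3 := congrArg NNReal.toReal h2.2
    rw [Real.coe_toNNReal _ h0, hY.isGaussianSpace.mixedMoment_smul_add (hY.mem hs) (hY.mem ht),
      hY.mixedMoment_self hs, hY.mixedMoment_self ht, Real.coe_toNNReal'] at h3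
    have hev : r (t - s) = r (s - t) := by rw [← hY.even, neg_sub]
    rw [mul_one] at h3
    rw [h3]
    congr 1
    simp [Fin.sum_univ_two, hY.apply_zero, hev]
    ring
  have h1 := key 1
  have h2 := key (-1)
  rcases le_total 0 ((1 : ℝ) ^ 2 + 2 * 1 * r (s - t) + 1) with a | a <;>
  rcases le_total 0 ((-1 : ℝ) ^ 2 + 2 * (-1) * r (s - t) + 1) with b | b <;>
  simp only [max_eq_left, max_eq_right, a, b] at h1 h2 <;> linarith

lemma abs_le_one (hY : IsStationaryGaussian P Y r) (t : ℝ) : |r t| ≤ 1 := by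
  have h : ∀ t, 0 ≤ t → |r t| ≤ 1 := by
    intro t ht
    have := hY.isGaussianSpace.sq_mixedMoment_le (hY.mem ht) (hY.mem le_rfl)
    rw [hY.mixedMoment_eq ht le_rfl, hY.mixedMoment_self ht, hY.mixedMoment_self le_rfl,
      sub_zero] at this
    linarith
  rcases le_total 0 t with ht | ht
  · exact h t ht
  · rw [← hY.even]; exact h (-t) (by linarith)

lemma integral_cexp_mul_cexp (hY : IsStationaryGaussian P Y r) {s t : ℝ} (hs : 0 ≤ s)
    (ht : 0 ≤ t) (x y : ℝ) :
    ∫ ω, Complex.exp (x * Y s ω * Complex.I) * Complex.exp (y * Y t ω * Complex.I) ∂P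
      = Complex.exp (-(x ^ 2 + y ^ 2) / 2 - r (s - t) * x * y) := by
  have h := hY.isGaussianSpace.integral_cexp_smul_add (hY.mem hs)
    (Submodule.smul_mem _ y (hY.mem ht)) x
  have e1 : mixedMoment P (Y s) (y • Y t) = y * r (s - t) := by
    rw [← hY.mixedMoment_eq hs ht, mixedMoment, mixedMoment, ← integral_const_mul]
    congr 1; ext ω; simp; ring
  have e2 : mixedMoment P (y • Y t) (y • Y t) = y ^ 2 := by
    rw [← mul_one (y ^ 2), ← hY.mixedMoment_self ht, mixedMoment, mixedMoment, ← integral_const_mul]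
    congr 1; ext ω; simp; ring
  rw [e1, e2, hY.mixedMoment_self hs] at h
  simp only [Pi.smul_apply, smul_eq_mul, Complex.ofReal_mul] at h
  rw [h]
  congr 1
  push_cast; ring

end IsStationaryGaussian

lemma ae_eq_zero_of_forall_integral_cos_sin {μ : Measure ℝ} [IsFiniteMeasure μ] {h : ℝ → ℝ}
    (mh : Measurable h) (ih : Integrable h μ) (hc : ∀ t, ∫ x, h x * cos (t * x) ∂μ = 0)
    (hs : ∀ t, ∫ x, h x * sin (t * x) ∂μ = 0) : h =ᵐ[μ] 0 := by
  have : IsFiniteMeasure (μ.withDensity fun x => ENNReal.ofReal (h x)) :=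
    isFiniteMeasure_withDensity_ofReal ih.2
  have : IsFiniteMeasure (μ.withDensity fun x => ENNReal.ofReal (-h x)) :=
    isFiniteMeasure_withDensity_ofReal ih.neg.2
  have key : μ.withDensity (fun x => ENNReal.ofReal (h x))
      = μ.withDensity fun x => ENNReal.ofReal (-h x) := by
    apply Measure.ext_of_charFun
    ext t
    rw [charFun_apply_real, charFun_apply_real,
      integral_withDensity_eq_integral_toReal_smul (by fun_prop) (by simp),
      integral_withDensity_eq_integral_toReal_smul (by fun_prop) (by simp), ← sub_eq_zero,
      ← integral_sub]
    · have e : ∀ x, (ENNReal.ofReal (h x)).toReal • Complex.exp (t * x * Complex.I)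
          - (ENNReal.ofReal (-h x)).toReal • Complex.exp (t * x * Complex.I)
          = ((h x * cos (t * x) : ℝ) : ℂ) + ((h x * sin (t * x) : ℝ) : ℂ) * Complex.I := by
        intro x
        rw [← sub_smul, ENNReal.toReal_ofReal', ENNReal.toReal_ofReal',
          max_zero_sub_eq_self, ← Complex.ofReal_mul, Complex.exp_mul_I, Complex.real_smul]
        push_cast; ring
      simp only [e]
      rw [integral_add, integral_mul_const, integral_complex_ofReal, integral_complex_ofReal,
        hc, hs]
      · simp
      · refine Integrable.ofReal (ih.mul_bdd (c := 1) (by fun_prop) (ae_of_all _ fun x => ?_))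
        simpa using abs_cos_le_one _
      · refine (Integrable.ofReal
          (ih.mul_bdd (c := 1) (by fun_prop) (ae_of_all _ fun x => ?_))).mul_const _
        simpa using abs_sin_le_one _
    · simp_rw [ENNReal.toReal_ofReal']
      simp_rw [Complex.real_smul]
      refine ih.pos_part.ofReal.mul_bdd (c := 1) (by fun_prop) (ae_of_all _ fun x => ?_)
      rw [← Complex.ofReal_mul, Complex.norm_exp_ofReal_mul_I]
    · simp_rw [ENNReal.toReal_ofReal']
      simp_rw [Complex.real_smul]
      refine ih.neg.pos_part.ofReal.mul_bdd (c := 1) (by fun_prop) (ae_of_all _ fun x => ?_)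
      rw [← Complex.ofReal_mul, Complex.norm_exp_ofReal_mul_I]
  refine ih.ae_eq_zero_of_forall_setIntegral_eq_zero fun s hs _ => ?_
  rw [integral_eq_lintegral_pos_part_sub_lintegral_neg_part ih.integrableOn,
    ← withDensity_apply _ hs, key, withDensity_apply _ hs, sub_self]

/-- Real trigonometric polynomials with arbitrary real frequencies. -/
def trigPoly : Submodule ℝ (ℝ → ℝ) :=
  Submodule.span ℝ ((range fun t x => cos (t * x)) ∪ range fun t x => sin (t * x))

lemma cos_mem_trigPoly (t : ℝ) : (fun x => cos (t * x)) ∈ trigPoly :=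
  Submodule.subset_span (Or.inl ⟨t, rfl⟩)

lemma sin_mem_trigPoly (t : ℝ) : (fun x => sin (t * x)) ∈ trigPoly :=
  Submodule.subset_span (Or.inr ⟨t, rfl⟩)

lemma const_mem_trigPoly (c : ℝ) : (fun _ => c) ∈ trigPoly := by
  convert! trigPoly.smul_mem c (cos_mem_trigPoly 0) using 1
  ext x; simp

lemma exists_eq_sum_of_mem_trigPoly {g : ℝ → ℝ} (hg : g ∈ trigPoly) :
    ∃ (n : ℕ) (a : Fin n → ℂ) (l : Fin n → ℝ),
      ∀ x, (g x : ℂ) = ∑ k, a k * Complex.exp (l k * x * Complex.I) := by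
  induction hg using Submodule.span_induction with
  | mem g hg =>
    rcases hg with ⟨t, rfl⟩ | ⟨t, rfl⟩
    · refine ⟨2, ![1 / 2, 1 / 2], ![t, -t], fun x => ?_⟩
      simp [Fin.sum_univ_two, Complex.cos]
      ring
    · refine ⟨2, ![-Complex.I / 2, Complex.I / 2], ![t, -t], fun x => ?_⟩
      simp [Fin.sum_univ_two, Complex.sin]
      ring
  | zero => exact ⟨0, 0, 0, by simp⟩
  | add g h _ _ ihg ihh =>
    obtain ⟨n, a, l, e⟩ := ihg
    obtain ⟨m, b, q, e'⟩ := ihh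
    refine ⟨n + m, Fin.append a b, Fin.append l q, fun x => ?_⟩
    simp [Fin.sum_univ_add, e, e']
  | smul c g _ ih =>
    obtain ⟨n, a, l, e⟩ := ih
    refine ⟨n, fun k => c * a k, l, fun x => ?_⟩
    simp [e, Finset.mul_sum, mul_assoc]

lemma continuous_of_mem_trigPoly {g : ℝ → ℝ} (hg : g ∈ trigPoly) : Continuous g := by
  obtain ⟨n, a, l, e⟩ := exists_eq_sum_of_mem_trigPoly hg
  have : g = fun x : ℝ => (∑ k, a k * Complex.exp (l k * x * Complex.I)).re := by
    ext x; rw [← e]; simp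
  rw [this]
  fun_prop

lemma exists_abs_le_of_mem_trigPoly {g : ℝ → ℝ} (hg : g ∈ trigPoly) : ∃ B, ∀ x, |g x| ≤ B := by
  obtain ⟨n, a, l, e⟩ := exists_eq_sum_of_mem_trigPoly hg
  refine ⟨∑ k, ‖a k‖, fun x => ?_⟩
  rw [← Real.norm_eq_abs, ← Complex.norm_real, e]
  refine norm_sum_le_of_le _ fun k _ => ?_
  rw [norm_mul, ← Complex.ofReal_mul, Complex.norm_exp_ofReal_mul_I, mul_one]

lemma memLp_of_mem_trigPoly {g : ℝ → ℝ} (hg : g ∈ trigPoly) {μ : Measure ℝ} [IsFiniteMeasure μ] :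
    MemLp g 2 μ := by
  obtain ⟨B, hB⟩ := exists_abs_le_of_mem_trigPoly hg
  exact MemLp.of_bound (continuous_of_mem_trigPoly hg).aestronglyMeasurable B (ae_of_all _ hB)

/-- Trigonometric polynomials are dense in `L²` of a finite measure. -/
lemma dense_trigPoly (μ : Measure ℝ) [IsFiniteMeasure μ] :
    Dense {F : Lp ℝ 2 μ | ∃ g ∈ trigPoly, F =ᵐ[μ] g} := by
  let K : Submodule ℝ (Lp ℝ 2 μ) :=
    { carrier := {F | ∃ g ∈ trigPoly, F =ᵐ[μ] g}
      zero_mem' := ⟨0, trigPoly.zero_mem, Lp.coeFn_zero _ _ _⟩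
      add_mem' := by
        rintro F G ⟨f, hf, e⟩ ⟨g, hg, e'⟩
        exact ⟨f + g, trigPoly.add_mem hf hg, (Lp.coeFn_add F G).trans (e.add e')⟩
      smul_mem' := by
        rintro c F ⟨f, hf, e⟩
        exact ⟨c • f, trigPoly.smul_mem c hf, (Lp.coeFn_smul c F).trans (e.const_smul c)⟩ }
  have hK : Kᗮ = ⊥ := by
    rw [Submodule.eq_bot_iff]
    intro h hh
    rw [Submodule.mem_orthogonal] at hh
    have key : ∀ g ∈ trigPoly, ∫ x, h x * g x ∂μ = 0 := by
      intro g hg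
      have := hh ((memLp_of_mem_trigPoly hg).toLp g) ⟨g, hg, MemLp.coeFn_toLp _⟩
      rw [L2.inner_def] at this
      rw [← this]
      refine integral_congr_ae ?_
      filter_upwards [MemLp.coeFn_toLp (memLp_of_mem_trigPoly hg (μ := μ))] with x hx
      rw [hx]; simp
    rw [Lp.eq_zero_iff_ae_eq_zero]
    exact ae_eq_zero_of_forall_integral_cos_sin (Lp.stronglyMeasurable h).measurable
      ((Lp.memLp h).integrable one_le_two) (fun t => key _ (cos_mem_trigPoly t))
      fun t => key _ (sin_mem_trigPoly t)
  have := Submodule.topologicalClosure_eq_top_iff.2 hK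
  exact (Submodule.dense_iff_topologicalClosure_eq_top (s := K)).2 this

lemma exists_mem_trigPoly_integral_sq_sub_le {μ : Measure ℝ} [IsFiniteMeasure μ] {f : ℝ → ℝ}
    (hf : MemLp f 2 μ) {ε : ℝ} (hε : 0 < ε) :
    ∃ g ∈ trigPoly, ∫ x, (f x - g x) ^ 2 ∂μ ≤ ε := by
  obtain ⟨G, ⟨g, hg, hGg⟩, hd⟩ := (dense_trigPoly μ).exists_dist_lt (hf.toLp f) (sqrt_pos.2 hε)
  refine ⟨g, hg, ?_⟩
  have e : ∫ x, (f x - g x) ^ 2 ∂μ = ‖hf.toLp f - G‖ ^ 2 := by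
    rw [← real_inner_self_eq_norm_sq, L2.inner_def]
    refine integral_congr_ae ?_
    filter_upwards [hf.coeFn_toLp, hGg, Lp.coeFn_sub (hf.toLp f) G] with x h1 h2 h3
    rw [h3, Pi.sub_apply, h1, h2]
    simp
  rw [e, ← dist_eq_norm, ← Real.sq_sqrt hε.le]
  gcongr

namespace IsStationaryGaussian

variable {Ω : Type*} [MeasurableSpace Ω] {P : Measure Ω} [IsProbabilityMeasure P]
  {Y : ℝ → Ω → ℝ} {r : ℝ → ℝ}

/-- The covariance of a trigonometric polynomial of the process is a power series in the
covariance of the process, with nonnegative coefficients. -/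
lemma exists_hasSum_integral_mul (hY : IsStationaryGaussian P Y r) {g : ℝ → ℝ}
    (hg : g ∈ trigPoly) :
    ∃ q : ℕ → ℝ, (∀ n, 0 ≤ q n) ∧ q 0 = (∫ x, g x ∂(gaussianReal 0 1)) ^ 2 ∧
      ∀ s t, 0 ≤ s → 0 ≤ t →
        HasSum (fun n => r (s - t) ^ n * q n) (∫ ω, g (Y s ω) * g (Y t ω) ∂P) := by
  obtain ⟨n, a, l, e⟩ := exists_eq_sum_of_mem_trigPoly hg
  let b : Fin n → ℂ := fun k => a k * Complex.exp (-(l k ^ 2 : ℝ) / 2)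
  have hce : ∀ x : ℝ, ‖Complex.exp (x * Complex.I)‖ = 1 := Complex.norm_exp_ofReal_mul_I
  refine ⟨fun m => ‖∑ k, b k * (l k : ℂ) ^ m‖ ^ 2 / m.factorial, fun m => by positivity, ?_, ?_⟩
  · have h1 : ((∫ x, g x ∂(gaussianReal 0 1) : ℝ) : ℂ) = ∑ k, b k := by
      rw [← integral_complex_ofReal]
      simp only [e]
      rw [integral_finsetSum]
      · refine Finset.sum_congr rfl fun k _ => ?_
        rw [integral_const_mul, ← charFun_apply_real, charFun_gaussianReal]
        simp [b, neg_div]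
      · intro k _
        refine (Integrable.of_bound (by fun_prop) 1 (ae_of_all _ fun x => ?_)).const_mul _
        rw [← Complex.ofReal_mul, hce]
    simp only [pow_zero, mul_one, Nat.factorial_zero, Nat.cast_one, div_one]
    rw [← h1, Complex.norm_real, Real.norm_eq_abs, sq_abs]
  · intro s t hs ht
    have ms := hY.measurable_apply s
    have mt := hY.measurable_apply t
    rw [← Complex.hasSum_ofReal, ← integral_complex_ofReal]
    have e1 : ∀ ω, ((g (Y s ω) * g (Y t ω) : ℝ) : ℂ) = ∑ k, ∑ j, a k * (starRingEnd ℂ) (a j)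
        * (Complex.exp (l k * Y s ω * Complex.I)
          * Complex.exp ((-l j : ℝ) * Y t ω * Complex.I)) := by
      intro ω
      rw [Complex.ofReal_mul, ← Complex.conj_ofReal (g (Y t ω)), e, e, map_sum, Finset.sum_mul_sum]
      refine Finset.sum_congr rfl fun k _ => Finset.sum_congr rfl fun j _ => ?_
      rw [map_mul, ← Complex.exp_conj]
      simp only [map_mul, Complex.conj_ofReal, Complex.conj_I]
      push_cast
      ring_nf
    have i1 : ∀ k j, Integrable (fun ω => a k * (starRingEnd ℂ) (a j)
        * (Complex.exp (l k * Y s ω * Complex.I)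
          * Complex.exp ((-l j : ℝ) * Y t ω * Complex.I))) P := by
      intro k j
      refine (Integrable.of_bound (by fun_prop) 1 (ae_of_all _ fun ω => ?_)).const_mul _
      rw [norm_mul, ← Complex.ofReal_mul, ← Complex.ofReal_mul, hce, hce, one_mul]
    simp only [e1]
    rw [integral_finsetSum _ fun k _ => integrable_finsetSum _ fun j _ => i1 k j]
    have e2 : ∀ k, ∫ ω, ∑ j, a k * (starRingEnd ℂ) (a j)
        * (Complex.exp (l k * Y s ω * Complex.I)
          * Complex.exp ((-l j : ℝ) * Y t ω * Complex.I)) ∂P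
        = ∑ j, b k * (starRingEnd ℂ) (b j)
          * Complex.exp ((r (s - t) : ℂ) * (l k * l j)) := by
      intro k
      rw [integral_finsetSum _ fun j _ => i1 k j]
      refine Finset.sum_congr rfl fun j _ => ?_
      rw [integral_const_mul, hY.integral_cexp_mul_cexp hs ht]
      simp only [b]
      rw [map_mul, ← Complex.exp_conj]
      simp only [map_div₀, map_neg, Complex.conj_ofReal, map_ofNat]
      have : Complex.exp (-((l k : ℂ) ^ 2 + ((-l j : ℝ) : ℂ) ^ 2) / 2
          - r (s - t) * l k * (-l j : ℝ))
          = Complex.exp (-(l k ^ 2 : ℝ) / 2) * Complex.exp (-(l j ^ 2 : ℝ) / 2)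
            * Complex.exp ((r (s - t) : ℂ) * (l k * l j)) := by
        rw [← Complex.exp_add, ← Complex.exp_add]
        congr 1; push_cast; ring
      rw [this]; ring
    simp only [e2]
    have key : HasSum (fun m : ℕ => ∑ k, ∑ j, b k * (starRingEnd ℂ) (b j)
        * ((r (s - t) : ℂ) ^ m / m.factorial * (l k * l j) ^ m))
        (∑ k, ∑ j, b k * (starRingEnd ℂ) (b j) * Complex.exp ((r (s - t) : ℂ) * (l k * l j))) :=
      hasSum_sum fun k _ => hasSum_sum fun j _ => (hasSum_cexp _ _).mul_left _
    refine key.congr_fun fun m => ?_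
    push_cast
    rw [← Complex.mul_conj', map_sum, Finset.sum_mul_sum, Finset.sum_div, Finset.mul_sum]
    refine Finset.sum_congr rfl fun k _ => ?_
    rw [Finset.sum_div, Finset.mul_sum]
    refine Finset.sum_congr rfl fun j _ => ?_
    simp only [map_mul, map_pow, Complex.conj_ofReal]
    ring

lemma inner_compMeasurePreserving (hY : IsStationaryGaussian P Y r) {s t : ℝ} (hs : 0 ≤ s)
    (ht : 0 ≤ t) {F : Lp ℝ 2 (gaussianReal 0 1)} {f : ℝ → ℝ} (hf : F =ᵐ[gaussianReal 0 1] f) :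
    inner ℝ (Lp.compMeasurePreserving (Y s) (hY.measurePreserving hs) F)
      (Lp.compMeasurePreserving (Y t) (hY.measurePreserving ht) F)
      = ∫ ω, f (Y s ω) * f (Y t ω) ∂P := by
  rw [L2.inner_def]
  refine integral_congr_ae ?_
  filter_upwards [Lp.coeFn_compMeasurePreserving F (hY.measurePreserving hs),
    Lp.coeFn_compMeasurePreserving F (hY.measurePreserving ht),
    (hY.measurePreserving hs).quasiMeasurePreserving.ae_eq_comp hf,
    (hY.measurePreserving ht).quasiMeasurePreserving.ae_eq_comp hf] with ω h1 h2 h3 h4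
  rw [h1, h2, h3, h4]
  simp [mul_comm]

/-- The covariance of `f (Y s)` and `f (Y t)` only depends on the covariance of `Y s`, `Y t`. -/
lemma integral_mul_eq (hY : IsStationaryGaussian P Y r) {f : ℝ → ℝ}
    (hf : MemLp f 2 (gaussianReal 0 1)) {s t s' t' : ℝ} (hs : 0 ≤ s) (ht : 0 ≤ t) (hs' : 0 ≤ s')
    (ht' : 0 ≤ t') (h : r (s - t) = r (s' - t')) :
    ∫ ω, f (Y s ω) * f (Y t ω) ∂P = ∫ ω, f (Y s' ω) * f (Y t' ω) ∂P := by
  have c := fun {u : ℝ} (hu : 0 ≤ u) =>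
    (Lp.isometry_compMeasurePreserving (E := ℝ) (p := 2) (hY.measurePreserving hu)).continuous
  have hcl : IsClosed {F : Lp ℝ 2 (gaussianReal 0 1) |
      inner ℝ (Lp.compMeasurePreserving (Y s) (hY.measurePreserving hs) F)
        (Lp.compMeasurePreserving (Y t) (hY.measurePreserving ht) F)
      = inner ℝ (Lp.compMeasurePreserving (Y s') (hY.measurePreserving hs') F)
        (Lp.compMeasurePreserving (Y t') (hY.measurePreserving ht') F)} :=
    isClosed_eq ((c hs).inner (c ht)) ((c hs').inner (c ht'))
  have := closure_minimal (s := {F : Lp ℝ 2 (gaussianReal 0 1) |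
      ∃ g ∈ trigPoly, F =ᵐ[gaussianReal 0 1] g}) (by
    rintro F ⟨g, hg, e⟩
    obtain ⟨q, -, -, hq⟩ := hY.exists_hasSum_integral_mul hg
    rw [mem_ofPred_eq, hY.inner_compMeasurePreserving hs ht e,
      hY.inner_compMeasurePreserving hs' ht' e]
    exact (h ▸ hq s t hs ht).unique (hq s' t' hs' ht')) hcl (dense_trigPoly _ (hf.toLp f))
  rwa [mem_ofPred_eq, hY.inner_compMeasurePreserving hs ht hf.coeFn_toLp,
      hY.inner_compMeasurePreserving hs' ht' hf.coeFn_toLp] at this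

/-- Gebelein's inequality: the covariance of `f (Y s)` and `f (Y t)` is at most
`|Cov (Y s, Y t)|` times the variance. -/
lemma abs_integral_mul_le (hY : IsStationaryGaussian P Y r) {f : ℝ → ℝ}
    (hf : MemLp f 2 (gaussianReal 0 1)) (hf0 : ∫ x, f x ∂(gaussianReal 0 1) = 0)
    {s t : ℝ} (hs : 0 ≤ s) (ht : 0 ≤ t) :
    |∫ ω, f (Y s ω) * f (Y t ω) ∂P| ≤ |r (s - t)| * ∫ x, f x ^ 2 ∂(gaussianReal 0 1) := by
  have c := fun {u : ℝ} (hu : 0 ≤ u) =>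
    (Lp.isometry_compMeasurePreserving (E := ℝ) (p := 2) (hY.measurePreserving hu)).continuous
  let one : Lp ℝ 2 (gaussianReal 0 1) := (memLp_const (1 : ℝ)).toLp _
  have inner_one : ∀ (F : Lp ℝ 2 (gaussianReal 0 1)) (g : ℝ → ℝ), F =ᵐ[gaussianReal 0 1] g →
      inner ℝ one F = ∫ x, g x ∂(gaussianReal 0 1) := by
    intro F g e
    rw [L2.inner_def]
    refine integral_congr_ae ?_
    filter_upwards [e, (memLp_const (1 : ℝ) (μ := gaussianReal 0 1) (p := 2)).coeFn_toLp]
      with x h1 h2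
    rw [h1, h2]; simp
  have inner_self : ∀ (F : Lp ℝ 2 (gaussianReal 0 1)) (g : ℝ → ℝ), F =ᵐ[gaussianReal 0 1] g →
      inner ℝ F F = ∫ x, g x ^ 2 ∂(gaussianReal 0 1) := by
    intro F g e
    rw [L2.inner_def]
    refine integral_congr_ae ?_
    filter_upwards [e] with x h1
    rw [h1]; simp
  have hcl : IsClosed {F : Lp ℝ 2 (gaussianReal 0 1) |
      |inner ℝ (Lp.compMeasurePreserving (Y s) (hY.measurePreserving hs) F)
        (Lp.compMeasurePreserving (Y t) (hY.measurePreserving ht) F) - inner ℝ one F ^ 2|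
      ≤ |r (s - t)| * (inner ℝ F F - inner ℝ one F ^ 2)} := by
    have hone : Continuous fun F : Lp ℝ 2 (gaussianReal 0 1) => inner ℝ one F ^ 2 :=
      (continuous_const.inner continuous_id).pow 2
    exact isClosed_le (((c hs).inner (c ht)).sub hone).abs
      (continuous_const.mul ((continuous_id.inner continuous_id).sub hone))
  have := closure_minimal (s := {F : Lp ℝ 2 (gaussianReal 0 1) |
      ∃ g ∈ trigPoly, F =ᵐ[gaussianReal 0 1] g}) (by
    rintro F ⟨g, hg, e⟩
    obtain ⟨q, hq0, hqm, hq⟩ := hY.exists_hasSum_integral_mul hg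
    have h1 : HasSum q (∫ x, g x ^ 2 ∂(gaussianReal 0 1)) := by
      have := hq 0 0 le_rfl le_rfl
      simp only [sub_self, hY.apply_zero, one_pow, one_mul] at this
      convert! this
      rw [← hY.map_apply le_rfl, integral_map (hY.measurable_apply 0).aemeasurable
        (by have := continuous_of_mem_trigPoly hg; fun_prop)]
      simp [sq]
    rw [mem_ofPred_eq, hY.inner_compMeasurePreserving hs ht e, inner_one F g e, inner_self F g e,
      ← hqm]
    have h2 := (hasSum_nat_add_iff' 1).2 h1
    have h3 := (hasSum_nat_add_iff' 1).2 (hq s t hs ht)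
    simp only [Finset.range_one, Finset.sum_singleton, pow_zero, one_mul] at h2 h3
    rw [← Real.norm_eq_abs, ← h3.tsum_eq]
    refine tsum_of_norm_bounded (h2.mul_left |r (s - t)|) fun m => ?_
    rw [norm_mul, norm_pow, Real.norm_eq_abs, Real.norm_of_nonneg (hq0 _)]
    refine mul_le_mul_of_nonneg_right ?_ (hq0 _)
    exact pow_le_of_le_one (abs_nonneg _) (hY.abs_le_one _) m.succ_ne_zero) hcl (dense_trigPoly _ (hf.toLp f))
  rwa [mem_ofPred_eq, hY.inner_compMeasurePreserving hs ht hf.coeFn_toLp,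
      inner_one _ _ hf.coeFn_toLp, inner_self _ _ hf.coeFn_toLp, hf0, zero_pow two_ne_zero,
      sub_zero, sub_zero] at this

end IsStationaryGaussian

/-- The integral of `f (Y u)` over the time interval `(0, T]`. -/
noncomputable def timeIntegral {Ω : Type*} (Y : ℝ → Ω → ℝ) (f : ℝ → ℝ) (T : ℝ) (ω : Ω) : ℝ :=
  ∫ u in Ioc 0 T, f (Y u ω)

/-- The autocovariance function of the process `f (Y u)`. -/
noncomputable def autocov {Ω : Type*} [MeasurableSpace Ω] (P : Measure Ω) (Y : ℝ → Ω → ℝ)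
    (f : ℝ → ℝ) (h : ℝ) : ℝ :=
  ∫ ω, f (Y |h| ω) * f (Y 0 ω) ∂P

namespace IsStationaryGaussian

variable {Ω : Type*} [MeasurableSpace Ω] {P : Measure Ω} [IsProbabilityMeasure P]
  {Y : ℝ → Ω → ℝ} {r f g : ℝ → ℝ} {T : ℝ}

lemma measurable_comp (hY : IsStationaryGaussian P Y r) (mf : Measurable f) :
    Measurable fun p : ℝ × Ω => f (Y p.1 p.2) :=
  mf.comp hY.measurable

lemma stronglyMeasurable_timeIntegral (hY : IsStationaryGaussian P Y r) (mf : Measurable f) :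
    StronglyMeasurable (timeIntegral Y f T) :=
  (hY.measurable_comp mf).stronglyMeasurable.integral_prod_left'

lemma memLp_comp (hY : IsStationaryGaussian P Y r) (hf : MemLp f 2 (gaussianReal 0 1))
    {u : ℝ} (hu : 0 ≤ u) : MemLp (fun ω => f (Y u ω)) 2 P :=
  hf.comp_measurePreserving (hY.measurePreserving hu)

lemma integral_comp (hY : IsStationaryGaussian P Y r) (mf : Measurable f) {u : ℝ} (hu : 0 ≤ u) :
    ∫ ω, f (Y u ω) ∂P = ∫ x, f x ∂(gaussianReal 0 1) := by
  rw [← hY.map_apply hu, integral_map (hY.measurable_apply u).aemeasurable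
    mf.aestronglyMeasurable]

lemma integral_comp_sq (hY : IsStationaryGaussian P Y r) (mf : Measurable f) {u : ℝ} (hu : 0 ≤ u) :
    ∫ ω, f (Y u ω) ^ 2 ∂P = ∫ x, f x ^ 2 ∂(gaussianReal 0 1) :=
  hY.integral_comp (f := fun x => f x ^ 2) (mf.pow_const 2) hu

lemma integral_abs_mul_le (hY : IsStationaryGaussian P Y r) (mf : Measurable f)
    (hf : MemLp f 2 (gaussianReal 0 1)) {u v : ℝ} (hu : 0 ≤ u) (hv : 0 ≤ v) :
    ∫ ω, |f (Y u ω) * f (Y v ω)| ∂P ≤ ∫ x, f x ^ 2 ∂(gaussianReal 0 1) := by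
  calc _ ≤ ∫ ω, (f (Y u ω) ^ 2 + f (Y v ω) ^ 2) / 2 ∂P := by
        refine integral_mono ((hY.memLp_comp hf hu).integrable_mul (hY.memLp_comp hf hv)).abs
          (((hY.memLp_comp hf hu).integrable_sq.add (hY.memLp_comp hf hv).integrable_sq).div_const
            2) fun ω => ?_
        rw [abs_mul, ← sq_abs (f (Y u ω)), ← sq_abs (f (Y v ω))]
        nlinarith [sq_nonneg (|f (Y u ω)| - |f (Y v ω)|)]
    _ = _ := by
        rw [integral_div, integral_add (hY.memLp_comp hf hu).integrable_sq
          (hY.memLp_comp hf hv).integrable_sq, hY.integral_comp_sq mf hu, hY.integral_comp_sq mf hv]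
        ring

lemma ae_nonneg_prod (T : ℝ) : ∀ᵐ p ∂((volume.restrict (Ioc 0 T)).prod
    (volume.restrict (Ioc (0 : ℝ) T))), 0 ≤ p.1 ∧ 0 ≤ p.2 := by
  rw [Measure.prod_restrict]
  filter_upwards [ae_restrict_mem (measurableSet_Ioc.prod measurableSet_Ioc)] with p hp
  exact ⟨hp.1.1.le, hp.2.1.le⟩

lemma integrable_comp_mul_comp (hY : IsStationaryGaussian P Y r) (mf : Measurable f)
    (hf : MemLp f 2 (gaussianReal 0 1)) :
    Integrable (fun p : Ω × ℝ × ℝ => f (Y p.2.1 p.1) * f (Y p.2.2 p.1))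
      (P.prod ((volume.restrict (Ioc 0 T)).prod (volume.restrict (Ioc 0 T)))) := by
  have hm : Measurable fun p : Ω × ℝ × ℝ => f (Y p.2.1 p.1) * f (Y p.2.2 p.1) := by
    have := hY.measurable_comp mf
    exact (this.comp (measurable_snd.fst.prodMk measurable_fst)).mul
      (this.comp (measurable_snd.snd.prodMk measurable_fst))
  rw [integrable_prod_iff' hm.aestronglyMeasurable]
  constructor
  · filter_upwards [ae_nonneg_prod T] with p hp
    exact (hY.memLp_comp hf hp.1).integrable_mul (hY.memLp_comp hf hp.2)
  · refine Integrable.of_bound ?_ (∫ x, f x ^ 2 ∂(gaussianReal 0 1)) ?_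
    · exact hm.stronglyMeasurable.norm.integral_prod_left'.aestronglyMeasurable
    · filter_upwards [ae_nonneg_prod T] with p hp
      rw [Real.norm_of_nonneg (integral_nonneg fun _ => norm_nonneg _)]
      exact hY.integral_abs_mul_le mf hf hp.1 hp.2

lemma integrable_comp_prod (hY : IsStationaryGaussian P Y r) (mf : Measurable f)
    (hf : Integrable f (gaussianReal 0 1)) :
    Integrable (fun p : Ω × ℝ => f (Y p.2 p.1)) (P.prod (volume.restrict (Ioc 0 T))) := by
  have hm : Measurable fun p : Ω × ℝ => f (Y p.2 p.1) :=
    (hY.measurable_comp mf).comp measurable_swap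
  rw [integrable_prod_iff' hm.aestronglyMeasurable]
  constructor
  · filter_upwards [ae_restrict_mem measurableSet_Ioc] with u hu
    exact (hY.measurePreserving hu.1.le).integrable_comp_of_integrable hf
  · refine (integrable_const (∫ x, ‖f x‖ ∂(gaussianReal 0 1))).congr ?_
    filter_upwards [ae_restrict_mem measurableSet_Ioc] with u hu
    exact (hY.integral_comp mf.norm hu.1.le).symm

lemma timeIntegral_sq (ω : Ω) :
    timeIntegral Y f T ω ^ 2 = ∫ p, f (Y p.1 ω) * f (Y p.2 ω)
      ∂((volume.restrict (Ioc 0 T)).prod (volume.restrict (Ioc 0 T))) := by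
  rw [integral_prod_mul (fun u => f (Y u ω)) fun u => f (Y u ω), sq]
  rfl

lemma memLp_timeIntegral (hY : IsStationaryGaussian P Y r) (mf : Measurable f)
    (hf : MemLp f 2 (gaussianReal 0 1)) : MemLp (timeIntegral Y f T) 2 P := by
  rw [memLp_two_iff_integrable_sq (hY.stronglyMeasurable_timeIntegral mf).aestronglyMeasurable]
  simp only [timeIntegral_sq]
  exact (hY.integrable_comp_mul_comp mf hf).integral_prod_left

lemma integral_timeIntegral (hY : IsStationaryGaussian P Y r) (mf : Measurable f)
    (hf : Integrable f (gaussianReal 0 1)) (hf0 : ∫ x, f x ∂(gaussianReal 0 1) = 0) :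
    ∫ ω, timeIntegral Y f T ω ∂P = 0 := by
  simp only [timeIntegral]
  rw [integral_integral_swap (hY.integrable_comp_prod mf hf)]
  refine integral_eq_zero_of_ae ?_
  filter_upwards [ae_restrict_mem measurableSet_Ioc] with u hu
  rw [hY.integral_comp mf hu.1.le, hf0, Pi.zero_apply]

lemma integral_timeIntegral_sq (hY : IsStationaryGaussian P Y r) (mf : Measurable f)
    (hf : MemLp f 2 (gaussianReal 0 1)) :
    ∫ ω, timeIntegral Y f T ω ^ 2 ∂P = ∫ p, autocov P Y f (p.1 - p.2)
      ∂((volume.restrict (Ioc 0 T)).prod (volume.restrict (Ioc 0 T))) := by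
  simp only [timeIntegral_sq]
  rw [integral_integral_swap (hY.integrable_comp_mul_comp mf hf)]
  refine integral_congr_ae ?_
  filter_upwards [ae_nonneg_prod T] with p hp
  refine hY.integral_mul_eq hf hp.1 hp.2 (abs_nonneg _) le_rfl ?_
  rw [sub_zero]
  rcases abs_choice (p.1 - p.2) with h | h <;> rw [h]
  rw [hY.even]

lemma ae_integrable_comp (hY : IsStationaryGaussian P Y r) (mf : Measurable f)
    (hf : Integrable f (gaussianReal 0 1)) :
    ∀ᵐ ω ∂P, IntegrableOn (fun u => f (Y u ω)) (Ioc 0 T) :=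
  (hY.integrable_comp_prod mf hf).prod_right_ae

lemma measurable_autocov (hY : IsStationaryGaussian P Y r) (mf : Measurable f) :
    Measurable (autocov P Y f) := by
  have h : Measurable fun p : ℝ × Ω => f (Y |p.1| p.2) * f (Y 0 p.2) :=
    ((hY.measurable_comp mf).comp ((measurable_fst.abs).prodMk measurable_snd)).mul
      ((hY.measurable_comp mf).comp (measurable_const.prodMk measurable_snd))
  exact h.stronglyMeasurable.integral_prod_right'.measurable

lemma abs_autocov_le (hY : IsStationaryGaussian P Y r)
    (hf : MemLp f 2 (gaussianReal 0 1)) (hf0 : ∫ x, f x ∂(gaussianReal 0 1) = 0) (h : ℝ) :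
    |autocov P Y f h| ≤ |r h| * ∫ x, f x ^ 2 ∂(gaussianReal 0 1) := by
  have := hY.abs_integral_mul_le hf hf0 (abs_nonneg h) le_rfl
  rw [sub_zero] at this
  have e : r |h| = r h := by
    rcases abs_choice h with h' | h' <;> rw [h']
    rw [hY.even]
  rwa [e] at this

lemma integrable_autocov (hY : IsStationaryGaussian P Y r) (hr : Integrable r) (mf : Measurable f)
    (hf : MemLp f 2 (gaussianReal 0 1)) (hf0 : ∫ x, f x ∂(gaussianReal 0 1) = 0) :
    Integrable (autocov P Y f) :=
  (hr.abs.mul_const _).mono' (hY.measurable_autocov mf).aestronglyMeasurable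
    (ae_of_all _ (hY.abs_autocov_le hf hf0))

lemma integral_abs_autocov_le (hY : IsStationaryGaussian P Y r) (hr : Integrable r)
    (mf : Measurable f)
    (hf : MemLp f 2 (gaussianReal 0 1)) (hf0 : ∫ x, f x ∂(gaussianReal 0 1) = 0) :
    ∫ h, |autocov P Y f h| ≤ (∫ h, |r h|) * ∫ x, f x ^ 2 ∂(gaussianReal 0 1) := by
  rw [← integral_mul_const]
  exact integral_mono (hY.integrable_autocov hr mf hf hf0).abs (hr.abs.mul_const _)
    (hY.abs_autocov_le hf hf0)

end IsStationaryGaussian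

/-- The length of the set of times `v` such that both `v` and `h + v` belong to `(0, T]`. -/
noncomputable def overlap (T h : ℝ) : ℝ :=
  (volume.restrict (Ioc 0 T)).real ((fun v => h + v) ⁻¹' Ioc 0 T)

lemma overlap_nonneg (T h : ℝ) : 0 ≤ overlap T h := measureReal_nonneg

lemma overlap_le {T : ℝ} (hT : 0 ≤ T) (h : ℝ) : overlap T h ≤ T := by
  calc _ ≤ (volume.restrict (Ioc 0 T)).real univ := measureReal_mono (subset_univ _)
    _ = T := by simp [hT]

lemma le_overlap (T h : ℝ) : T - |h| ≤ overlap T h := by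
  rw [overlap, measureReal_restrict_apply (measurableSet_Ioc.preimage (by fun_prop))]
  have hs : Ioc (max 0 (-h)) (min T (T - h)) ⊆ (fun v => h + v) ⁻¹' Ioc 0 T ∩ Ioc 0 T := by
    rintro v ⟨h1, h2⟩
    simp only [max_lt_iff, le_min_iff] at h1 h2
    refine ⟨⟨?_, ?_⟩, h1.1, h2.1⟩ <;> simp only <;> linarith
  have h2 : volume.real (Ioc (max 0 (-h)) (min T (T - h))) ≤ _ :=
    measureReal_mono hs (measure_ne_top_of_subset inter_subset_right (by simp))
  refine le_trans ?_ h2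
  rw [Measure.real, Real.volume_Ioc, ENNReal.toReal_ofReal']
  refine le_trans ?_ (le_max_left _ _)
  rcases abs_cases h with ⟨h1, h2⟩ | ⟨h1, h2⟩ <;>
  rcases max_cases 0 (-h) with ⟨h3, h4⟩ | ⟨h3, h4⟩ <;>
  rcases min_cases T (T - h) with ⟨h5, h6⟩ | ⟨h5, h6⟩ <;> linarith

lemma measurable_overlap (T : ℝ) : Measurable (overlap T) := by
  have : MeasurableSet {p : ℝ × ℝ | p.1 + p.2 ∈ Ioc 0 T} :=
    measurableSet_Ioc.preimage (by fun_prop)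
  exact (measurable_measure_prodMk_left this).ennreal_toReal

lemma integral_prod_sub {ρ : ℝ → ℝ} (mρ : Measurable ρ) (hρ : Integrable ρ) (T : ℝ) :
    ∫ p, ρ (p.1 - p.2) ∂((volume.restrict (Ioc 0 T)).prod (volume.restrict (Ioc 0 T)))
      = ∫ h, ρ h * overlap T h := by
  have hI : Integrable (fun p : ℝ × ℝ => ρ p.1 * (Ioc 0 T).indicator 1 (p.1 + p.2))
      (volume.prod (volume.restrict (Ioc 0 T))) := by
    refine (hρ.comp_fst (volume.restrict (Ioc 0 T))).mul_bdd (c := 1) ?_ (ae_of_all _ fun p => ?_)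
    · exact ((measurable_one.indicator measurableSet_Ioc).comp
        (measurable_fst.add measurable_snd)).aestronglyMeasurable
    · simp only [indicator]; split_ifs <;> simp
  have hI2 : Integrable (fun p : ℝ × ℝ => ρ (p.1 - p.2))
      ((volume.restrict (Ioc 0 T)).prod (volume.restrict (Ioc 0 T))) := by
    have hm : Measurable fun p : ℝ × ℝ => ρ (p.1 - p.2) := by fun_prop
    rw [integrable_prod_iff' hm.aestronglyMeasurable]
    refine ⟨ae_of_all _ fun v => (hρ.comp_sub_right v).restrict,
      Integrable.of_bound hm.stronglyMeasurable.norm.integral_prod_left'.aestronglyMeasurable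
        (∫ h, ‖ρ h‖) (ae_of_all _ fun v => ?_)⟩
    rw [Real.norm_of_nonneg (integral_nonneg fun _ => norm_nonneg _),
      ← integral_sub_right_eq_self (fun h => ‖ρ h‖) v]
    exact setIntegral_le_integral (hρ.comp_sub_right v).norm (ae_of_all _ fun _ => norm_nonneg _)
  rw [integral_prod_symm _ hI2]
  have e : ∀ v, ∫ u in Ioc 0 T, ρ (u - v) = ∫ h, ρ h * (Ioc 0 T).indicator 1 (h + v) := by
    intro v
    rw [← integral_sub_right_eq_self (fun h => ρ h * (Ioc 0 T).indicator 1 (h + v)) v,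
      ← integral_indicator measurableSet_Ioc]
    congr 1; ext u
    by_cases hu : u ∈ Ioc 0 T <;> simp [hu, indicator]
  simp only [e]
  rw [← integral_integral_swap hI]
  congr 1; ext h
  rw [integral_const_mul]
  congr 1
  have : (fun v => (Ioc 0 T).indicator (1 : ℝ → ℝ) (h + v))
      = ((fun v => h + v) ⁻¹' Ioc 0 T).indicator 1 := rfl
  rw [this, integral_indicator_one (measurableSet_Ioc.preimage (by fun_prop))]
  rfl

lemma tendsto_integral_mul_overlap {ρ : ℝ → ℝ} (hρ : Integrable ρ) :
    Tendsto (fun T => (∫ h, ρ h * overlap T h) / T) atTop (nhds (∫ h, ρ h)) := by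
  simp_rw [← integral_div, mul_div_assoc]
  refine tendsto_integral_filter_of_dominated_convergence (fun h => ‖ρ h‖) ?_ ?_ hρ.norm ?_
  · exact Eventually.of_forall fun T =>
      hρ.aestronglyMeasurable.mul ((measurable_overlap T).div_const T).aestronglyMeasurable
  · filter_upwards [eventually_gt_atTop 0] with T hT
    refine ae_of_all _ fun h => ?_
    rw [norm_mul, Real.norm_of_nonneg (div_nonneg (overlap_nonneg T h) hT.le)]
    exact mul_le_of_le_one_right (norm_nonneg _) (div_le_one_of_le₀ (overlap_le hT.le h) hT.le)
  · refine ae_of_all _ fun h => ?_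
    have : Tendsto (fun T => overlap T h / T) atTop (nhds 1) := by
      have h1 : Tendsto (fun T : ℝ => 1 - |h| / T) atTop (nhds 1) := by
        simpa using (tendsto_const_nhds (x := (1 : ℝ))).sub
          ((tendsto_const_nhds (x := |h|)).div_atTop tendsto_id)
      refine tendsto_of_tendsto_of_tendsto_of_le_of_le' h1 tendsto_const_nhds ?_ ?_
      · filter_upwards [eventually_gt_atTop 0] with T hT
        rw [one_sub_div hT.ne']
        exact div_le_div_of_nonneg_right (le_overlap T h) hT.le
      · filter_upwards [eventually_gt_atTop 0] with T hT
        exact div_le_one_of_le₀ (overlap_le hT.le h) hT.le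
    simpa using this.const_mul (ρ h)

lemma abs_integral_mul_overlap_le {ρ : ℝ → ℝ} (hρ : Integrable ρ) {T : ℝ} (hT : 0 ≤ T) :
    |∫ h, ρ h * overlap T h| ≤ (∫ h, |ρ h|) * T := by
  rw [← integral_mul_const, ← Real.norm_eq_abs]
  refine norm_integral_le_of_norm_le (hρ.abs.mul_const T) (ae_of_all _ fun h => ?_)
  rw [norm_mul, Real.norm_of_nonneg (overlap_nonneg T h)]
  exact mul_le_mul_of_nonneg_left (overlap_le hT h) (norm_nonneg _)

namespace IsStationaryGaussian

variable {Ω : Type*} [MeasurableSpace Ω] {P : Measure Ω} [IsProbabilityMeasure P]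
  {Y : ℝ → Ω → ℝ} {r f : ℝ → ℝ} {T : ℝ}

lemma integral_timeIntegral_sq_le (hY : IsStationaryGaussian P Y r) (hr : Integrable r)
    (mf : Measurable f) (hf : MemLp f 2 (gaussianReal 0 1))
    (hf0 : ∫ x, f x ∂(gaussianReal 0 1) = 0) (hT : 0 ≤ T) :
    ∫ ω, timeIntegral Y f T ω ^ 2 ∂P
      ≤ (∫ h, |r h|) * (∫ x, f x ^ 2 ∂(gaussianReal 0 1)) * T := by
  have hρ := hY.integrable_autocov hr mf hf hf0
  rw [hY.integral_timeIntegral_sq mf hf, integral_prod_sub (hY.measurable_autocov mf) hρ]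
  exact (le_abs_self _).trans <| (abs_integral_mul_overlap_le hρ hT).trans <|
    mul_le_mul_of_nonneg_right (hY.integral_abs_autocov_le hr mf hf hf0) hT

/-- The variance of `timeIntegral` grows linearly, at the rate given by the integrated
autocovariance. -/
lemma tendsto_integral_timeIntegral_sq (hY : IsStationaryGaussian P Y r) (hr : Integrable r)
    (mf : Measurable f) (hf : MemLp f 2 (gaussianReal 0 1))
    (hf0 : ∫ x, f x ∂(gaussianReal 0 1) = 0) :
    Tendsto (fun T => (∫ ω, timeIntegral Y f T ω ^ 2 ∂P) / T) atTop
      (nhds (∫ h, autocov P Y f h)) := by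
  have hρ := hY.integrable_autocov hr mf hf hf0
  simp only [hY.integral_timeIntegral_sq mf hf, integral_prod_sub (hY.measurable_autocov mf) hρ]
  exact tendsto_integral_mul_overlap hρ

end IsStationaryGaussian

/-- The difference between the characteristic function of `X` at `1` and that of the centered
Gaussian with the same second moment. -/
noncomputable def gaussianDefect {Ω : Type*} [MeasurableSpace Ω] (P : Measure Ω) (X : Ω → ℝ) : ℂ :=
  ∫ ω, Complex.exp (X ω * Complex.I) ∂P - Real.exp (-(∫ ω, X ω ^ 2 ∂P) / 2)

lemma mixedMoment_const_mul_const_mul {Ω : Type*} [MeasurableSpace Ω] (P : Measure Ω)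
    (ξ η : Ω → ℝ) (c d : ℝ) :
    mixedMoment P (fun ω => c * ξ ω) (fun ω => d * η ω) = c * d * mixedMoment P ξ η := by
  rw [mixedMoment, mixedMoment, ← integral_const_mul]
  congr 1; ext ω; ring

namespace IsStationaryGaussian

variable {Ω : Type*} [MeasurableSpace Ω] {P : Measure Ω} [IsProbabilityMeasure P]
  {Y : ℝ → Ω → ℝ} {r f g : ℝ → ℝ} {T : ℝ}

lemma isExpFamily (hY : IsStationaryGaussian P Y r) {n : ℕ} (a : Fin n → ℂ) (l : Fin n → ℝ) :
    IsExpFamily (A := Fin n × ℝ) P (Submodule.span ℝ (Y '' Ici 0)) (fun x => a x.1)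
      (fun p => l p.1.1 * Y (max p.1.2 0) p.2) (∑ k, (‖a k‖ + l k ^ 2)) where
  gaussian := hY.isGaussianSpace
  measurable_coeff := (measurable_of_finite a).comp measurable_fst
  measurable := by
    refine ((measurable_of_finite l).comp measurable_fst.fst).mul ?_
    exact hY.measurable.comp ((measurable_fst.snd.max measurable_const).prodMk measurable_snd)
  mem x := Submodule.smul_mem _ (l x.1) (hY.mem (le_max_right x.2 0))
  norm_coeff_le x := by
    refine le_trans ?_ (Finset.single_le_sum (f := fun k => ‖a k‖ + l k ^ 2)
      (fun k _ => by positivity) (Finset.mem_univ x.1))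
    linarith [sq_nonneg (l x.1)]
  mixedMoment_le x := by
    dsimp only
    rw [mixedMoment_const_mul_const_mul, hY.mixedMoment_self (le_max_right _ _)]
    refine le_trans ?_ (Finset.single_le_sum (f := fun k => ‖a k‖ + l k ^ 2)
      (fun k _ => by positivity) (Finset.mem_univ x.1))
    nlinarith [norm_nonneg (a x.1)]

lemma integral_count_prod {E : Type*} [NormedAddCommGroup E] [NormedSpace ℝ E] [CompleteSpace E]
    {n : ℕ} {ν : Measure ℝ} [SFinite ν] {F : Fin n × ℝ → E} (hF : Integrable F (Measure.count.prod ν)) :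
    ∫ x, F x ∂(Measure.count.prod ν) = ∑ k, ∫ v, F (k, v) ∂ν := by
  rw [integral_prod _ hF, integral_count]

lemma covNorm_le (hY : IsStationaryGaussian P Y r) (hr : Integrable r) {n : ℕ} (a : Fin n → ℂ)
    (l : Fin n → ℝ) (x : Fin n × ℝ) :
    covNorm P (Measure.count.prod (volume.restrict (Ioc 0 T))) (fun x : Fin n × ℝ => a x.1)
      (fun p => l p.1.1 * Y (max p.1.2 0) p.2) (fun ω => l x.1 * Y (max x.2 0) ω)
      ≤ (∑ j, ∑ k, ‖a k‖ * |l j * l k|) * ∫ h, |r h| := by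
  have hint := (hY.isExpFamily a l).integrable_covNorm
    (α := Measure.count.prod (volume.restrict (Ioc 0 T))) ((hY.isExpFamily a l).mem x)
  have hR : 0 ≤ ∫ h, |r h| := integral_nonneg fun _ => abs_nonneg _
  rw [covNorm, integral_count_prod hint]
  have e : ∀ k, ∫ v in Ioc 0 T, ‖a k‖ * |mixedMoment P (fun ω => l x.1 * Y (max x.2 0) ω)
      (fun ω => l k * Y (max v 0) ω)| ≤ ‖a k‖ * |l x.1 * l k| * ∫ h, |r h| := by
    intro k
    rw [← integral_sub_left_eq_self (fun h => |r h|) _ (max x.2 0), ← integral_const_mul]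
    refine le_trans (le_of_eq ?_) (setIntegral_le_integral (s := Ioc 0 T)
      ((hr.comp_sub_left (max x.2 0)).abs.const_mul _) (ae_of_all _ fun v => by positivity))
    refine setIntegral_congr_fun measurableSet_Ioc fun v hv => ?_
    rw [mixedMoment_const_mul_const_mul, hY.mixedMoment_eq (le_max_right _ _) (le_max_right _ _),
      abs_mul, max_eq_left hv.1.le, mul_assoc]
  refine (Finset.sum_le_sum fun k _ => e k).trans ?_
  rw [← Finset.sum_mul]
  refine mul_le_mul_of_nonneg_right ?_ hR
  exact Finset.single_le_sum (f := fun j => ∑ k, ‖a k‖ * |l j * l k|)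
      (fun j _ => by positivity) (Finset.mem_univ x.1)

lemma expSum_eq (hY : IsStationaryGaussian P Y r) {n : ℕ} {a : Fin n → ℂ} {l : Fin n → ℝ}
    (e : ∀ x, (g x : ℂ) = ∑ k, a k * Complex.exp (l k * x * Complex.I)) (ω : Ω) :
    expSum (Measure.count.prod (volume.restrict (Ioc 0 T))) (fun x : Fin n × ℝ => a x.1)
      (fun p => l p.1.1 * Y (max p.1.2 0) p.2) ω = timeIntegral Y g T ω := by
  have hY' : Measurable fun u => Y u ω := hY.measurable.of_uncurry_right
  have hi : Integrable (fun x : Fin n × ℝ => a x.1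
      * Complex.exp ((l x.1 * Y (max x.2 0) ω : ℝ) * Complex.I))
      (Measure.count.prod (volume.restrict (Ioc 0 T))) := by
    have h := hY.isExpFamily a l
    refine Integrable.of_bound ?_ (∑ k, (‖a k‖ + l k ^ 2)) (ae_of_all _ fun x => ?_)
    · have m1 := h.measurable_coeff
      have m2 := h.measurable.comp (measurable_prodMk_right (y := ω))
      exact (m1.mul (by fun_prop)).aestronglyMeasurable
    · rw [norm_mul, Complex.norm_exp_ofReal_mul_I, mul_one]
      exact h.norm_coeff_le x
  rw [expSum, integral_count_prod hi, timeIntegral, ← integral_complex_ofReal,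
    ← integral_finsetSum]
  · refine setIntegral_congr_fun measurableSet_Ioc fun v hv => ?_
    simp only [e, max_eq_left hv.1.le, Complex.ofReal_mul]
  · intro k _
    refine Integrable.of_bound ?_ ‖a k‖ (ae_of_all _ fun v => ?_)
    · exact Measurable.aestronglyMeasurable (by fun_prop)
    · rw [norm_mul, Complex.norm_exp_ofReal_mul_I, mul_one]

lemma integral_normalized_sq (hT : 0 ≤ T) :
    ∫ ω, ((√T)⁻¹ * timeIntegral Y f T ω) ^ 2 ∂P = (∫ ω, timeIntegral Y f T ω ^ 2 ∂P) / T := by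
  simp only [mul_pow]
  rw [integral_const_mul, inv_pow, Real.sq_sqrt hT, inv_mul_eq_div]

lemma exists_norm_gaussianDefect_le (hY : IsStationaryGaussian P Y r) (hr : Integrable r)
    (hg : g ∈ trigPoly) (hg0 : ∫ x, g x ∂(gaussianReal 0 1) = 0) :
    ∃ K, ∀ T > 0, ‖gaussianDefect P fun ω => (√T)⁻¹ * timeIntegral Y g T ω‖ ≤ K / √T := by
  obtain ⟨n, a, l, e⟩ := exists_eq_sum_of_mem_trigPoly hg
  set D := (∑ j, ∑ k, ‖a k‖ * |l j * l k|) * ∫ h, |r h|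
  set C := ∑ k, (‖a k‖ + l k ^ 2)
  refine ⟨2 * D ^ 2 * (C * n), fun T hT => ?_⟩
  have hs := sqrt_pos.2 hT
  have hsq := Real.sq_sqrt hT.le
  have mg := (continuous_of_mem_trigPoly hg).measurable
  have key := (hY.isExpFamily a l).norm_charFun_sub_le
    (α := Measure.count.prod (volume.restrict (Ioc 0 T))) (D := D)
    (fun ω => by rw [hY.expSum_eq e]; simp) (fun x => hY.covNorm_le hr a l x)
    (by
      simp only [hY.expSum_eq e]
      rw [integral_complex_ofReal, hY.integral_timeIntegral mg
        ((memLp_of_mem_trigPoly hg).integrable one_le_two) hg0, Complex.ofReal_zero])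
    (t := (√T)⁻¹) (by positivity)
  have hvol : (Measure.count.prod (volume.restrict (Ioc 0 T))).real (univ : Set (Fin n × ℝ))
      = n * T := by
    rw [← univ_prod_univ, measureReal_prod_prod]
    simp [hT.le, Measure.real]
  simp only [hY.expSum_eq e, Complex.ofReal_re, hvol] at key
  have e1 : ∀ ω, Complex.exp (((√T)⁻¹ * timeIntegral Y g T ω : ℝ) * Complex.I)
      = Complex.exp (((√T)⁻¹ : ℝ) * Complex.I * timeIntegral Y g T ω) := by
    intro ω; congr 1; push_cast; ring
  have e2 : 2 * D ^ 2 * (C * n) / √T = 2 * D ^ 2 * (C * (n * T)) * (√T)⁻¹ ^ 3 := by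
    rw [inv_pow, show √T ^ 3 = √T ^ 2 * √T by ring, hsq]
    field_simp
  rw [gaussianDefect, integral_normalized_sq hT.le]
  simp only [e1]
  rwa [e2, div_eq_mul_inv _ T, ← hsq, ← inv_pow, hsq]

end IsStationaryGaussian

lemma norm_cexp_sub_cexp_le (x y : ℝ) :
    ‖Complex.exp (x * Complex.I) - Complex.exp (y * Complex.I)‖ ≤ |x - y| := by
  have e : Complex.exp (x * Complex.I) - Complex.exp (y * Complex.I)
      = Complex.exp (y * Complex.I) * (Complex.exp (Complex.I * (x - y : ℝ)) - 1) := by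
    rw [mul_sub, ← Complex.exp_add, mul_one]
    congr 2; push_cast; ring
  rw [e, norm_mul, Complex.norm_exp_ofReal_mul_I, one_mul]
  exact Real.norm_exp_I_mul_ofReal_sub_one_le

lemma abs_exp_neg_sub_exp_neg_le {a b : ℝ} (ha : 0 ≤ a) (hb : 0 ≤ b) :
    |Real.exp (-a / 2) - Real.exp (-b / 2)| ≤ |a - b| / 2 := by
  wlog h : a ≤ b generalizing a b
  · rw [abs_sub_comm, abs_sub_comm a]
    exact this hb ha (le_of_not_ge h)
  have h1 : Real.exp (-b / 2) ≤ Real.exp (-a / 2) := by gcongr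
  rw [abs_of_nonneg (by linarith), abs_sub_comm, abs_of_nonneg (by linarith)]
  have h2 : Real.exp (-b / 2) = Real.exp (-a / 2) * Real.exp (-(b - a) / 2) := by
    rw [← Real.exp_add]; congr 1; ring
  have h3 : Real.exp (-a / 2) ≤ 1 := by rw [Real.exp_le_one_iff]; linarith
  have h4 := Real.add_one_le_exp (-(b - a) / 2)
  rw [h2]
  nlinarith [Real.exp_pos (-a / 2)]

/-- `gaussianDefect` is uniformly continuous on bounded subsets of `L²`. -/
lemma norm_gaussianDefect_sub_le {Ω : Type*} [MeasurableSpace Ω] {P : Measure Ω}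
    [IsProbabilityMeasure P] {X X' : Ω → ℝ} (hX : MemLp X 2 P) (hX' : MemLp X' 2 P) {δ : ℝ}
    (hδ : 0 < δ) :
    ‖gaussianDefect P X - gaussianDefect P X'‖
      ≤ δ * (1 + ∫ ω, X ω ^ 2 ∂P) + (2 / δ + 1) * ∫ ω, (X ω - X' ω) ^ 2 ∂P := by
  have hd := hX.sub hX'
  have id : Integrable (fun ω => (X ω - X' ω) ^ 2) P := hd.integrable_sq
  have ic : ∀ {Z : Ω → ℝ}, MemLp Z 2 P → Integrable (fun ω => Complex.exp (Z ω * Complex.I)) P := by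
    intro Z hZ
    have := hZ.aestronglyMeasurable.aemeasurable
    exact Integrable.of_bound (by fun_prop) 1
      (ae_of_all _ fun ω => (Complex.norm_exp_ofReal_mul_I _).le)
  have h1 : ‖∫ ω, Complex.exp (X ω * Complex.I) ∂P - ∫ ω, Complex.exp (X' ω * Complex.I) ∂P‖
      ≤ δ + 1 / δ * ∫ ω, (X ω - X' ω) ^ 2 ∂P := by
    rw [← integral_sub (ic hX) (ic hX'), ← integral_const_mul]
    have : δ = ∫ _, δ ∂P := by simp
    rw [this, ← integral_add (integrable_const _) (id.const_mul _)]
    refine norm_integral_le_of_norm_le ((integrable_const _).add (id.const_mul _))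
      (ae_of_all _ fun ω => (norm_cexp_sub_cexp_le _ _).trans ?_)
    rw [← this, ← sq_abs]
    have := abs_nonneg (X ω - X' ω)
    rw [← sub_nonneg]
    have e : δ + 1 / δ * |X ω - X' ω| ^ 2 - |X ω - X' ω|
        = ((δ - |X ω - X' ω|) ^ 2 + δ * |X ω - X' ω|) / δ := by field_simp; ring
    rw [e]; positivity
  have h2 : |∫ ω, X ω ^ 2 ∂P - ∫ ω, X' ω ^ 2 ∂P|
      ≤ δ * ∫ ω, X ω ^ 2 ∂P + (1 / δ + 1) * ∫ ω, (X ω - X' ω) ^ 2 ∂P := by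
    rw [← Real.norm_eq_abs, ← integral_sub hX.integrable_sq hX'.integrable_sq, ← integral_const_mul,
      ← integral_const_mul, ← integral_add (hX.integrable_sq.const_mul _) (id.const_mul _)]
    refine norm_integral_le_of_norm_le ((hX.integrable_sq.const_mul _).add (id.const_mul _))
      (ae_of_all _ fun ω => ?_)
    rw [Real.norm_eq_abs, abs_le]
    constructor <;> rw [← sub_nonneg]
    · have e : X ω ^ 2 - X' ω ^ 2 - -(δ * X ω ^ 2 + (1 / δ + 1) * (X ω - X' ω) ^ 2)
          = (δ * X ω + (X ω - X' ω)) ^ 2 / δ := by field_simp; ring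
      rw [e]; positivity
    · have e : δ * X ω ^ 2 + (1 / δ + 1) * (X ω - X' ω) ^ 2 - (X ω ^ 2 - X' ω ^ 2)
          = (δ * X ω - (X ω - X' ω)) ^ 2 / δ + 2 * (X ω - X' ω) ^ 2 := by field_simp; ring
      rw [e]; positivity
  have h3 := abs_exp_neg_sub_exp_neg_le (integral_nonneg fun ω => sq_nonneg (X ω))
    (integral_nonneg fun ω => sq_nonneg (X' ω)) (a := ∫ ω, X ω ^ 2 ∂P) (b := ∫ ω, X' ω ^ 2 ∂P)
  have i1 : 0 ≤ ∫ ω, X ω ^ 2 ∂P := integral_nonneg fun ω => sq_nonneg (X ω)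
  have i2 : 0 ≤ ∫ ω, (X ω - X' ω) ^ 2 ∂P := integral_nonneg fun ω => sq_nonneg _
  rw [gaussianDefect, gaussianDefect, sub_sub_sub_comm, ← Complex.ofReal_sub]
  refine (norm_sub_le _ _).trans ?_
  rw [Complex.norm_real, Real.norm_eq_abs]
  have e : δ * (1 + ∫ ω, X ω ^ 2 ∂P) + (2 / δ + 1) * ∫ ω, (X ω - X' ω) ^ 2 ∂P
      = (δ + 1 / δ * ∫ ω, (X ω - X' ω) ^ 2 ∂P) + (δ * ∫ ω, X ω ^ 2 ∂P
        + (1 / δ + 1) * ∫ ω, (X ω - X' ω) ^ 2 ∂P) := by ring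
  rw [e]
  have : 0 ≤ |∫ ω, X ω ^ 2 ∂P - ∫ ω, X' ω ^ 2 ∂P| := abs_nonneg _
  linarith

lemma exists_mem_trigPoly_integral_eq_zero {μ : Measure ℝ} [IsProbabilityMeasure μ] {f : ℝ → ℝ}
    (hf : MemLp f 2 μ) (hf0 : ∫ x, f x ∂μ = 0) {ε : ℝ} (hε : 0 < ε) :
    ∃ g ∈ trigPoly, ∫ x, g x ∂μ = 0 ∧ ∫ x, (f x - g x) ^ 2 ∂μ ≤ ε := by
  obtain ⟨g, hg, h⟩ := exists_mem_trigPoly_integral_sq_sub_le hf hε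
  have hg2 := memLp_of_mem_trigPoly hg (μ := μ)
  have ig := hg2.integrable one_le_two
  have ifg : Integrable (fun x => f x - g x) μ := (hf.integrable one_le_two).sub ig
  have ifg2 : Integrable (fun x => (f x - g x) ^ 2) μ := (hf.sub hg2).integrable_sq
  set c := ∫ x, g x ∂μ with hc
  refine ⟨g - fun _ => c, trigPoly.sub_mem hg (const_mem_trigPoly c), ?_, ?_⟩
  · simp only [Pi.sub_apply]
    rw [integral_sub ig (integrable_const _)]
    simp [hc]
  · have e : ∀ x, (f x - (g - fun _ => c : ℝ → ℝ) x) ^ 2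
        = (f x - g x) ^ 2 + 2 * c * (f x - g x) + c ^ 2 := by
      intro x; simp only [Pi.sub_apply]; ring
    have e0 : ∫ x, (f x - g x) ∂μ = -c := by
      rw [integral_sub (hf.integrable one_le_two) ig, hf0, zero_sub]
    simp only [e]
    rw [integral_add (ifg2.fun_add (ifg.const_mul _)) (integrable_const _),
      integral_add ifg2 (ifg.const_mul _), integral_const_mul]
    rw [e0]
    simp
    nlinarith [sq_nonneg c]

namespace IsStationaryGaussian

variable {Ω : Type*} [MeasurableSpace Ω] {P : Measure Ω} [IsProbabilityMeasure P]
  {Y : ℝ → Ω → ℝ} {r f : ℝ → ℝ} {T : ℝ}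

lemma integral_normalized_sq_le (hY : IsStationaryGaussian P Y r) (hr : Integrable r)
    (mf : Measurable f) (hf : MemLp f 2 (gaussianReal 0 1))
    (hf0 : ∫ x, f x ∂(gaussianReal 0 1) = 0) (hT : 0 < T) :
    ∫ ω, ((√T)⁻¹ * timeIntegral Y f T ω) ^ 2 ∂P
      ≤ (∫ h, |r h|) * ∫ x, f x ^ 2 ∂(gaussianReal 0 1) := by
  rw [integral_normalized_sq hT.le, div_le_iff₀ hT]
  exact hY.integral_timeIntegral_sq_le hr mf hf hf0 hT.le

lemma tendsto_gaussianDefect (hY : IsStationaryGaussian P Y r) (hr : Integrable r)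
    (mf : Measurable f) (hf : MemLp f 2 (gaussianReal 0 1))
    (hf0 : ∫ x, f x ∂(gaussianReal 0 1) = 0) :
    Tendsto (fun T => gaussianDefect P fun ω => (√T)⁻¹ * timeIntegral Y f T ω) atTop (nhds 0) := by
  rw [NormedAddGroup.tendsto_nhds_zero]
  intro ε hε
  set R := ∫ h, |r h|
  set m := ∫ x, f x ^ 2 ∂(gaussianReal 0 1)
  have hR : 0 ≤ R := integral_nonneg fun _ => abs_nonneg _
  have hm : 0 ≤ m := integral_nonneg fun _ => sq_nonneg _
  obtain ⟨δ, hδ, hδε⟩ : ∃ δ > 0, δ * (1 + R * m) ≤ ε / 4 :=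
    ⟨ε / 4 / (1 + R * m), by positivity, by rw [div_mul_cancel₀]; positivity⟩
  obtain ⟨η, hη, hηε⟩ : ∃ η > 0, (2 / δ + 1) * (R * η) ≤ ε / 4 := by
    refine ⟨ε / 4 / ((2 / δ + 1) * (R + 1)), by positivity, ?_⟩
    rw [← mul_assoc, mul_div_assoc', div_le_iff₀ (by positivity)]
    have : 0 ≤ (2 / δ + 1) * (ε / 4) := by positivity
    nlinarith
  obtain ⟨g, hg, hg0, hfg⟩ := exists_mem_trigPoly_integral_eq_zero hf hf0 hη
  have mg := (continuous_of_mem_trigPoly hg).measurable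
  have hg2 := memLp_of_mem_trigPoly hg (μ := gaussianReal 0 1)
  obtain ⟨K, hK⟩ := hY.exists_norm_gaussianDefect_le hr hg hg0
  have hlim : Tendsto (fun T => K / √T) atTop (nhds 0) :=
    tendsto_const_nhds.div_atTop tendsto_sqrt_atTop
  filter_upwards [eventually_gt_atTop 0, hlim.eventually_lt_const (half_pos hε)] with T hT hKT
  have h1 := norm_gaussianDefect_sub_le ((hY.memLp_timeIntegral mf hf (T := T)).const_mul (√T)⁻¹)
    ((hY.memLp_timeIntegral mg hg2 (T := T)).const_mul (√T)⁻¹) hδ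
  have h2 := hY.integral_normalized_sq_le hr mf hf hf0 hT
  have h3 : ∫ ω, ((√T)⁻¹ * timeIntegral Y f T ω - (√T)⁻¹ * timeIntegral Y g T ω) ^ 2 ∂P
      ≤ R * η := by
    have h4 := hY.integral_normalized_sq_le hr (mf.sub mg) (hf.sub hg2) (by
      simp only [Pi.sub_apply]
      rw [integral_sub (hf.integrable one_le_two) (hg2.integrable one_le_two), hf0, hg0,
        sub_zero]) hT
    refine le_trans (le_of_eq ?_) (h4.trans (mul_le_mul_of_nonneg_left hfg hR))
    refine integral_congr_ae ?_
    filter_upwards [hY.ae_integrable_comp mf (hf.integrable one_le_two) (T := T),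
      hY.ae_integrable_comp mg (hg2.integrable one_le_two) (T := T)] with ω i1 i2
    have : timeIntegral Y (f - g) T ω = timeIntegral Y f T ω - timeIntegral Y g T ω :=
      integral_sub i1 i2
    rw [this, mul_sub]
  have h5 := hK T hT
  have h6 := norm_le_norm_add_norm_sub (gaussianDefect P fun ω => (√T)⁻¹ * timeIntegral Y g T ω)
    (gaussianDefect P fun ω => (√T)⁻¹ * timeIntegral Y f T ω)
  have h7 : δ * (1 + ∫ ω, ((√T)⁻¹ * timeIntegral Y f T ω) ^ 2 ∂P) ≤ δ * (1 + R * m) := by gcongr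
  have h8 : (2 / δ + 1) * ∫ ω, ((√T)⁻¹ * timeIntegral Y f T ω - (√T)⁻¹ * timeIntegral Y g T ω) ^ 2 ∂P
      ≤ (2 / δ + 1) * (R * η) := by gcongr
  rw [norm_sub_rev] at h6
  linarith

/-- Breuer–Major theorem for the normalized time integral of `f (Y u)`, in terms of the
characteristic function. -/
theorem tendsto_integral_cexp (hY : IsStationaryGaussian P Y r) (hr : Integrable r)
    (mf : Measurable f) (hf : MemLp f 2 (gaussianReal 0 1))
    (hf0 : ∫ x, f x ∂(gaussianReal 0 1) = 0) :
    Tendsto (fun T => ∫ ω, Complex.exp (((√T)⁻¹ * timeIntegral Y f T ω : ℝ) * Complex.I) ∂P)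
      atTop (nhds (Real.exp (-(∫ h, autocov P Y f h) / 2))) := by
  have h1 : Tendsto (fun T => ((Real.exp (-(∫ ω, ((√T)⁻¹ * timeIntegral Y f T ω) ^ 2 ∂P) / 2) : ℝ)
      : ℂ)) atTop (nhds (Real.exp (-(∫ h, autocov P Y f h) / 2) : ℝ)) := by
    refine (Complex.continuous_ofReal.tendsto _).comp ((Real.continuous_exp.tendsto _).comp ?_)
    refine Tendsto.div_const (Tendsto.neg ?_) 2
    refine (hY.tendsto_integral_timeIntegral_sq hr mf hf hf0).congr' ?_
    filter_upwards [eventually_ge_atTop 0] with T hT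
    rw [integral_normalized_sq hT]
  have := (hY.tendsto_gaussianDefect hr mf hf hf0).add h1
  rw [zero_add] at this
  refine this.congr fun T => ?_
  rw [gaussianDefect, sub_add_cancel]

end IsStationaryGaussian

lemma integral_comp_neg_gaussianReal {f : ℝ → ℝ} (mf : Measurable f) :
    ∫ x, f (-x) ∂(gaussianReal 0 1) = ∫ x, f x ∂(gaussianReal 0 1) := by
  have h := gaussianReal_map_neg (μ := 0) (v := 1)
  rw [neg_zero] at h
  conv_rhs => rw [← h, integral_map (by fun_prop) mf.aestronglyMeasurable]

lemma integral_max_gaussianReal :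
    ∫ x, max x 0 ∂(gaussianReal 0 1) = 1 / √(2 * π) := by
  rw [integral_gaussianReal_eq_integral_smul one_ne_zero]
  have e : ∀ x, gaussianPDFReal 0 1 x • max x 0
      = (Ioi 0).indicator (fun x => (√(2 * π))⁻¹ * (x * Real.exp (-(1 / 2) * x ^ 2))) x := by
    intro x
    rcases lt_or_ge 0 x with h | h
    · rw [indicator_of_mem (mem_Ioi.2 h), gaussianPDFReal, max_eq_left h.le, smul_eq_mul]
      simp only [NNReal.coe_one, sub_zero, mul_one]
      rw [show -x ^ 2 / 2 = -(1 / 2) * x ^ 2 by ring]; ring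
    · rw [indicator_of_notMem (by simpa using h), max_eq_right h, smul_zero]
  have h2 : ∫ x in Ioi (0 : ℝ), x * Real.exp (-(1 / 2) * x ^ 2) = 1 := by
    have := integral_mul_cexp_neg_mul_sq (b := (1 / 2 : ℂ)) (by norm_num)
    rw [← Complex.ofReal_inj, ← integral_complex_ofReal]
    push_cast
    rw [this]; norm_num
  simp only [e]
  rw [integral_indicator measurableSet_Ioi, integral_const_mul, h2, mul_one, one_div]

lemma memLp_max_gaussianReal : MemLp (fun x : ℝ => max x 0) 4 (gaussianReal 0 1) :=
  MemLp.of_le (memLp_id_gaussianReal 4) (by fun_prop) (ae_of_all _ fun x => by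
    rw [Real.norm_of_nonneg (le_max_right _ _), id, Real.norm_eq_abs]
    exact max_le (le_abs_self x) (abs_nonneg x))

lemma integral_max_sq_gaussianReal :
    ∫ x, max x 0 ^ 2 ∂(gaussianReal 0 1) = 1 / 2 := by
  have h1 : ∫ x, x ^ 2 ∂(gaussianReal 0 1) = 1 := by
    have := variance_eq_sub (memLp_id_gaussianReal (μ := 0) (v := 1) 2)
    rw [variance_id_gaussianReal] at this
    simpa using this.symm
  have i1 : Integrable (fun x : ℝ => max x 0 ^ 2) (gaussianReal 0 1) :=
    (memLp_max_gaussianReal.mono_exponent (by norm_num)).integrable_sq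
  have i2 : Integrable (fun x : ℝ => max (-x) 0 ^ 2) (gaussianReal 0 1) := by
    have h := gaussianReal_map_neg (μ := 0) (v := 1)
    rw [neg_zero] at h
    exact MeasurePreserving.integrable_comp_of_integrable ⟨by fun_prop, h⟩ i1
  have h2 := integral_comp_neg_gaussianReal (f := fun x => max x 0 ^ 2) (by fun_prop)
  have h3 : ∫ x, (max x 0 ^ 2 + max (-x) 0 ^ 2) ∂(gaussianReal 0 1) = 1 := by
    rw [← h1]
    congr 1; ext x
    rcases le_total 0 x with h | h
    · rw [max_eq_left h, max_eq_right (by linarith)]; ring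
    · rw [max_eq_right h, max_eq_left (by linarith)]; ring
  rw [integral_add i1 i2, h2] at h3
  linarith

/-- The function with slope `a` on the positive and slope `b` on the negative half-line. -/
noncomputable def oscillate (a b y : ℝ) : ℝ :=
  a * y * (if 0 < y then 1 else 0) + b * y * (if y < 0 then 1 else 0)

lemma oscillate_eq (a b y : ℝ) : oscillate a b y = a * max y 0 - b * max (-y) 0 := by
  rcases lt_trichotomy 0 y with h | rfl | h
  · simp [oscillate, h, h.le, h.le.not_gt]
  · simp [oscillate]
  · simp [oscillate, h, h.le, h.le.not_gt]

lemma oscillate_sq_eq (a b y : ℝ) :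
    oscillate a b y ^ 2 = a ^ 2 * max y 0 ^ 2 + b ^ 2 * max (-y) 0 ^ 2 := by
  rw [oscillate_eq]
  rcases le_total 0 y with h | h
  · rw [max_eq_right (show -y ≤ 0 by linarith)]; ring
  · rw [max_eq_right h]; ring

lemma measurable_oscillate (a b : ℝ) : Measurable (oscillate a b) := by
  have : oscillate a b = fun y => a * max y 0 - b * max (-y) 0 := funext (oscillate_eq a b)
  rw [this]; fun_prop

lemma memLp_max_neg_gaussianReal : MemLp (fun x : ℝ => max (-x) 0) 4 (gaussianReal 0 1) := by
  have h := gaussianReal_map_neg (μ := 0) (v := 1)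
  rw [neg_zero] at h
  exact memLp_max_gaussianReal.comp_measurePreserving ⟨by fun_prop, h⟩

lemma memLp_oscillate (a b : ℝ) : MemLp (oscillate a b) 4 (gaussianReal 0 1) := by
  have : oscillate a b = fun y => a * max y 0 - b * max (-y) 0 := funext (oscillate_eq a b)
  rw [this]
  exact (memLp_max_gaussianReal.const_mul a).sub (memLp_max_neg_gaussianReal.const_mul b)

lemma memLp_oscillate_sq (a b : ℝ) :
    MemLp (fun y => oscillate a b y ^ 2) 2 (gaussianReal 0 1) := by
  have h := memLp_oscillate a b
  rw [memLp_two_iff_integrable_sq ((measurable_oscillate a b).pow_const 2).aestronglyMeasurable]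
  have := h.integrable_norm_pow (by norm_num)
  refine this.congr (ae_of_all _ fun x => ?_)
  simp only [Real.norm_eq_abs, ← pow_mul]
  norm_num
  exact Even.pow_abs (by decide) _

lemma integral_oscillate (a b : ℝ) :
    ∫ y, oscillate a b y ∂(gaussianReal 0 1) = (a - b) / √(2 * π) := by
  simp only [oscillate_eq]
  rw [integral_sub ((memLp_max_gaussianReal.integrable (by norm_num)).const_mul _)
      ((memLp_max_neg_gaussianReal.integrable (by norm_num)).const_mul _), integral_const_mul,
    integral_const_mul, integral_comp_neg_gaussianReal (f := fun x => max x 0) (by fun_prop),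
    integral_max_gaussianReal]
  ring

lemma integral_oscillate_sq (a b : ℝ) :
    ∫ y, oscillate a b y ^ 2 ∂(gaussianReal 0 1) = (a ^ 2 + b ^ 2) / 2 := by
  simp only [oscillate_sq_eq]
  have i1 := (memLp_max_gaussianReal.mono_exponent (p := 2) (by norm_num)).integrable_sq
  have i2 := (memLp_max_neg_gaussianReal.mono_exponent (p := 2) (by norm_num)).integrable_sq
  rw [integral_add (i1.const_mul _) (i2.const_mul _), integral_const_mul, integral_const_mul,
    integral_comp_neg_gaussianReal (f := fun x => max x 0 ^ 2) (by fun_prop),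
    integral_max_sq_gaussianReal]
  ring

namespace IsStationaryGaussian

variable {Ω : Type*} [MeasurableSpace Ω] {P : Measure Ω} [IsProbabilityMeasure P]
  {Y : ℝ → Ω → ℝ} {r f g : ℝ → ℝ} {T : ℝ}

lemma autocov_smul_add_smul (hY : IsStationaryGaussian P Y r)
    (hf : MemLp f 2 (gaussianReal 0 1)) (hg : MemLp g 2 (gaussianReal 0 1)) (c d h : ℝ) :
    autocov P Y (c • f + d • g) h = c ^ 2 * autocov P Y f h
      + c * d * (autocov P Y (f + g) h - autocov P Y f h - autocov P Y g h)
      + d ^ 2 * autocov P Y g h := by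
  have key : ∀ c d : ℝ, autocov P Y (c • f + d • g) h = c ^ 2 * autocov P Y f h
      + c * d * ((∫ ω, f (Y |h| ω) * g (Y 0 ω) ∂P) + ∫ ω, g (Y |h| ω) * f (Y 0 ω) ∂P)
      + d ^ 2 * autocov P Y g h := by
    intro c d
    have f1 := hY.memLp_comp hf (abs_nonneg h)
    have f0 := hY.memLp_comp hf le_rfl
    have g1 := hY.memLp_comp hg (abs_nonneg h)
    have g0 := hY.memLp_comp hg le_rfl
    have iff : Integrable (fun ω => f (Y |h| ω) * f (Y 0 ω)) P := f1.integrable_mul f0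
    have ifg : Integrable (fun ω => f (Y |h| ω) * g (Y 0 ω)) P := f1.integrable_mul g0
    have igf : Integrable (fun ω => g (Y |h| ω) * f (Y 0 ω)) P := g1.integrable_mul f0
    have igg : Integrable (fun ω => g (Y |h| ω) * g (Y 0 ω)) P := g1.integrable_mul g0
    rw [autocov, autocov, autocov, ← integral_add ifg igf, ← integral_const_mul,
      ← integral_const_mul, ← integral_const_mul,
      ← integral_add (iff.const_mul _) ((ifg.fun_add igf).const_mul _),
      ← integral_add ((iff.const_mul _).fun_add ((ifg.fun_add igf).const_mul _))
        (igg.const_mul _)]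
    congr 1; ext ω
    simp only [Pi.add_apply, Pi.smul_apply, smul_eq_mul]
    ring
  have h1 := key 1 1
  rw [one_smul, one_smul] at h1
  rw [key c d, h1]
  ring

lemma integral_autocov_smul_add_smul (hY : IsStationaryGaussian P Y r) (hr : Integrable r)
    (mf : Measurable f) (hf : MemLp f 2 (gaussianReal 0 1))
    (hf0 : ∫ x, f x ∂(gaussianReal 0 1) = 0)
    (mg : Measurable g) (hg : MemLp g 2 (gaussianReal 0 1))
    (hg0 : ∫ x, g x ∂(gaussianReal 0 1) = 0) (c d : ℝ) :
    ∫ h, autocov P Y (c • f + d • g) h = c ^ 2 * (∫ h, autocov P Y f h)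
      + c * d * ((∫ h, autocov P Y (f + g) h) - (∫ h, autocov P Y f h) - ∫ h, autocov P Y g h)
      + d ^ 2 * ∫ h, autocov P Y g h := by
  have i1 := hY.integrable_autocov hr mf hf hf0
  have i2 := hY.integrable_autocov hr mg hg hg0
  have i3 := hY.integrable_autocov hr (mf.add mg) (hf.add hg) (by
    simp only [Pi.add_apply]
    rw [integral_add (hf.integrable one_le_two) (hg.integrable one_le_two), hf0, hg0, add_zero])
  have i4 : Integrable fun h => autocov P Y (f + g) h - autocov P Y f h - autocov P Y g h :=
    (i3.sub i1).sub i2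
  simp only [hY.autocov_smul_add_smul hf hg]
  rw [integral_add ((i1.const_mul _).fun_add (i4.const_mul _)) (i2.const_mul _),
    integral_add (i1.const_mul _) (i4.const_mul _), integral_const_mul, integral_const_mul,
    integral_const_mul, integral_sub (i3.sub' i1) i2, integral_sub i3 i1]

lemma integral_autocov_nonneg (hY : IsStationaryGaussian P Y r) (hr : Integrable r)
    (mf : Measurable f) (hf : MemLp f 2 (gaussianReal 0 1))
    (hf0 : ∫ x, f x ∂(gaussianReal 0 1) = 0) : 0 ≤ ∫ h, autocov P Y f h := by
  refine ge_of_tendsto (hY.tendsto_integral_timeIntegral_sq hr mf hf hf0) ?_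
  filter_upwards [eventually_ge_atTop 0] with T hT
  exact div_nonneg (integral_nonneg fun ω => sq_nonneg _) hT

end IsStationaryGaussian

lemma Matrix.PosSemidef.dotProduct_mulVec_fin_two {S : Matrix (Fin 2) (Fin 2) ℝ}
    (hS : S.PosSemidef) (x : Fin 2 → ℝ) :
    x ⬝ᵥ S.mulVec x = x 0 ^ 2 * S 0 0 + 2 * x 0 * x 1 * S 0 1 + x 1 ^ 2 * S 1 1 := by
  have h : S 1 0 = S 0 1 := by simpa using hS.isHermitian.apply 0 1
  simp only [dotProduct, Matrix.mulVec, Fin.sum_univ_two, h]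
  ring

lemma map_multivariateGaussian_fin_two {S : Matrix (Fin 2) (Fin 2) ℝ} (hS : S.PosSemidef)
    (c d : ℝ) :
    (multivariateGaussian 0 S).map (fun x => c * x 0 + d * x 1)
      = gaussianReal 0 (Real.toNNReal (c ^ 2 * S 0 0 + 2 * c * d * S 0 1 + d ^ 2 * S 1 1)) := by
  have : IsProbabilityMeasure ((multivariateGaussian 0 S).map
      (fun x : EuclideanSpace ℝ (Fin 2) => c * x 0 + d * x 1)) :=
    Measure.isProbabilityMeasure_map (by fun_prop)
  refine Measure.ext_of_charFun (funext fun t => ?_)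
  have hq := hS.dotProduct_mulVec_fin_two (![c, d])
  have h0 : 0 ≤ c ^ 2 * S 0 0 + 2 * c * d * S 0 1 + d ^ 2 * S 1 1 := by
    have := hS.dotProduct_mulVec_nonneg ![c, d]
    rw [star_trivial, hq] at this
    simpa using this
  have hx := charFun_multivariateGaussian (μ := 0) hS !₂[t * c, t * d]
  rw [hS.dotProduct_mulVec_fin_two, charFun_apply] at hx
  rw [charFun_apply_real, integral_map (by fun_prop) (by fun_prop), charFun_gaussianReal,
    Real.coe_toNNReal _ h0]
  convert! hx using 2
  · ext x
    simp [PiLp.inner_apply, Fin.sum_univ_two]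
    ring_nf
  · simp
    ring

/-- The Cramér–Wold device combined with Lévy's continuity theorem, for pairs of random
variables with a Gaussian limit. -/
lemma tendsto_integral_of_tendsto_charFun {Ω : Type*} [MeasurableSpace Ω] {P : Measure Ω}
    [IsProbabilityMeasure P] {U V : ℝ → Ω → ℝ} (mU : ∀ T, Measurable (U T))
    (mV : ∀ T, Measurable (V T)) {S : Matrix (Fin 2) (Fin 2) ℝ} (hS : S.PosSemidef)
    (h : ∀ c d : ℝ, Tendsto
      (fun T => ∫ ω, Complex.exp ((c * U T ω + d * V T ω : ℝ) * Complex.I) ∂P) atTop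
      (nhds (Real.exp (-(c ^ 2 * S 0 0 + 2 * c * d * S 0 1 + d ^ 2 * S 1 1) / 2) : ℝ)))
    (f : BoundedContinuousFunction (ℝ × ℝ) ℝ) :
    Tendsto (fun T => ∫ ω, f (U T ω, V T ω) ∂P) atTop
      (nhds (∫ x, f (x 0, x 1) ∂(multivariateGaussian 0 S))) := by
  refine tendsto_of_seq_tendsto fun x hx => ?_
  have mW : ∀ T, Measurable fun ω => !₂[U T ω, V T ω] := fun T => by
    have := mU T
    have := mV T
    refine (PiLp.continuous_toLp 2 _).measurable.comp (measurable_pi_iff.2 fun i => ?_)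
    fin_cases i <;> simpa
  have hP : ∀ T, IsProbabilityMeasure (P.map fun ω => !₂[U T ω, V T ω]) := fun T =>
    Measure.isProbabilityMeasure_map (mW T).aemeasurable
  let ν : ℕ → ProbabilityMeasure (EuclideanSpace ℝ (Fin 2)) := fun n => ⟨_, hP (x n)⟩
  let ν₀ : ProbabilityMeasure (EuclideanSpace ℝ (Fin 2)) :=
    ⟨multivariateGaussian 0 S, inferInstance⟩
  have key : Tendsto ν atTop (nhds ν₀) := by
    refine ProbabilityMeasure.tendsto_of_tendsto_charFun fun t => ?_
    have h1 := (h (t 0) (t 1)).comp hx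
    have e0 : charFun (ν₀ : Measure (EuclideanSpace ℝ (Fin 2))) t = (Real.exp
        (-(t 0 ^ 2 * S 0 0 + 2 * t 0 * t 1 * S 0 1 + t 1 ^ 2 * S 1 1) / 2) : ℝ) := by
      change charFun (multivariateGaussian 0 S) t = _
      rw [charFun_multivariateGaussian hS, hS.dotProduct_mulVec_fin_two, inner_zero_right,
        Complex.ofReal_exp]
      push_cast
      congr 1
      ring
    rw [e0]
    refine h1.congr fun n => ?_
    change _ = charFun (P.map fun ω => !₂[U (x n) ω, V (x n) ω]) t
    rw [charFun_apply, integral_map (mW _).aemeasurable (by fun_prop)]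
    simp [PiLp.inner_apply, Fin.sum_univ_two, mul_comm]
  have := ProbabilityMeasure.tendsto_iff_forall_integral_tendsto.1 key
    (f.compContinuous ⟨fun y => (y 0, y 1), by fun_prop⟩)
  refine this.congr fun n => ?_
  change ∫ y : EuclideanSpace ℝ (Fin 2), f (y 0, y 1) ∂(P.map fun ω => !₂[U (x n) ω, V (x n) ω]) = _
  rw [integral_map (mW _).aemeasurable (by fun_prop)]
  simp

namespace IsStationaryGaussian

variable {Ω : Type*} [MeasurableSpace Ω] {P : Measure Ω} [IsProbabilityMeasure P]
  {Y : ℝ → Ω → ℝ} {r : ℝ → ℝ} {f g : ℝ → ℝ}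

/-- The limiting covariance matrix of the time integrals of `f (Y u)` and `g (Y u)`. -/
noncomputable def asymptoticCov (P : Measure Ω) (Y : ℝ → Ω → ℝ) (f g : ℝ → ℝ) :
    Matrix (Fin 2) (Fin 2) ℝ :=
  let b := (∫ h, autocov P Y (f + g) h) - (∫ h, autocov P Y f h) - ∫ h, autocov P Y g h
  !![∫ h, autocov P Y f h, b / 2; b / 2, ∫ h, autocov P Y g h]

lemma integral_autocov_eq_asymptoticCov (hY : IsStationaryGaussian P Y r) (hr : Integrable r)
    (mf : Measurable f) (hf : MemLp f 2 (gaussianReal 0 1)) (hf0 : ∫ x, f x ∂(gaussianReal 0 1) = 0)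
    (mg : Measurable g) (hg : MemLp g 2 (gaussianReal 0 1)) (hg0 : ∫ x, g x ∂(gaussianReal 0 1) = 0)
    (c d : ℝ) :
    ∫ h, autocov P Y (c • f + d • g) h = c ^ 2 * asymptoticCov P Y f g 0 0
      + 2 * c * d * asymptoticCov P Y f g 0 1 + d ^ 2 * asymptoticCov P Y f g 1 1 := by
  rw [hY.integral_autocov_smul_add_smul hr mf hf hf0 mg hg hg0]
  simp [asymptoticCov]
  ring

lemma integral_smul_add_smul_eq_zero (hf : MemLp f 2 (gaussianReal 0 1))
    (hf0 : ∫ x, f x ∂(gaussianReal 0 1) = 0)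
    (hg : MemLp g 2 (gaussianReal 0 1)) (hg0 : ∫ x, g x ∂(gaussianReal 0 1) = 0) (c d : ℝ) :
    ∫ x, (c • f + d • g) x ∂(gaussianReal 0 1) = 0 := by
  have i1 := (hf.integrable (by norm_num)).const_mul c
  have i2 := (hg.integrable (by norm_num)).const_mul d
  simp only [Pi.add_apply, Pi.smul_apply, smul_eq_mul]
  rw [integral_add i1 i2, integral_const_mul, integral_const_mul, hf0, hg0]
  ring

lemma posSemidef_asymptoticCov (hY : IsStationaryGaussian P Y r) (hr : Integrable r)
    (mf : Measurable f) (hf : MemLp f 2 (gaussianReal 0 1)) (hf0 : ∫ x, f x ∂(gaussianReal 0 1) = 0)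
    (mg : Measurable g) (hg : MemLp g 2 (gaussianReal 0 1))
    (hg0 : ∫ x, g x ∂(gaussianReal 0 1) = 0) : (asymptoticCov P Y f g).PosSemidef := by
  refine Matrix.PosSemidef.of_dotProduct_mulVec_nonneg ?_ fun x => ?_
  · ext i j
    fin_cases i <;> fin_cases j <;> simp [asymptoticCov]
  · have h := hY.integral_autocov_nonneg hr ((mf.const_smul (x 0)).add (mg.const_smul (x 1)))
      ((hf.const_smul (x 0)).add (hg.const_smul (x 1)))
      (integral_smul_add_smul_eq_zero hf hf0 hg hg0 _ _)
    rw [hY.integral_autocov_eq_asymptoticCov hr mf hf hf0 mg hg hg0] at h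
    convert! h using 1
    have hs : asymptoticCov P Y f g 1 0 = asymptoticCov P Y f g 0 1 := by simp [asymptoticCov]
    simp only [dotProduct, Matrix.mulVec, Fin.sum_univ_two, hs, star_trivial]
    ring

/-- The centered and normalized time averages are normalized time integrals of the centered
functions. -/
lemma ae_normalized_average_eq (hY : IsStationaryGaussian P Y r) (mf : Measurable f)
    (hf : Integrable f (gaussianReal 0 1)) (mg : Measurable g)
    (hg : Integrable g (gaussianReal 0 1)) (a b c d : ℝ) {T : ℝ} (hT : 0 < T) :
    ∀ᵐ ω ∂P, c * (√T * (1 / T * timeIntegral Y f T ω - a))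
        + d * (√T * (1 / T * timeIntegral Y g T ω - b))
      = (√T)⁻¹ * timeIntegral Y (c • (fun y => f y - a) + d • (fun y => g y - b)) T ω := by
  filter_upwards [hY.ae_integrable_comp mf hf (T := T), hY.ae_integrable_comp mg hg (T := T)]
    with ω h1 h2
  have hs := Real.sq_sqrt hT.le
  have hs0 : √T ≠ 0 := (Real.sqrt_pos.2 hT).ne'
  have e : timeIntegral Y (c • (fun y => f y - a) + d • (fun y => g y - b)) T ω
      = c * (timeIntegral Y f T ω - T * a) + d * (timeIntegral Y g T ω - T * b) := by
    have k1 : IntegrableOn (fun _ => a) (Ioc 0 T) := integrableOn_const (by simp)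
    have k2 : IntegrableOn (fun _ => b) (Ioc 0 T) := integrableOn_const (by simp)
    simp only [timeIntegral, Pi.add_apply, Pi.smul_apply, smul_eq_mul]
    rw [integral_add ((h1.sub' k1).const_mul c) ((h2.sub' k2).const_mul d), integral_const_mul,
      integral_const_mul, integral_sub h1 k1, integral_sub h2 k2]
    simp [hT.le]
  rw [e, show 1 / T = (√T)⁻¹ * (√T)⁻¹ by rw [← mul_inv, ← sq, hs, one_div]]
  have : T = √T * √T := by rw [← sq, hs]
  generalize √T = s at *
  subst this
  field_simp

/-- Central limit theorem for the time averages of two functions of the process. -/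
theorem tendsto_integral_normalized_average (hY : IsStationaryGaussian P Y r) (hr : Integrable r)
    (mf : Measurable f) (hf : MemLp f 2 (gaussianReal 0 1))
    (mg : Measurable g) (hg : MemLp g 2 (gaussianReal 0 1)) :
    ∃ S : Matrix (Fin 2) (Fin 2) ℝ, S.PosSemidef ∧
      ∀ φ : BoundedContinuousFunction (ℝ × ℝ) ℝ, Tendsto
        (fun T => ∫ ω, φ
          (√T * (1 / T * timeIntegral Y f T ω - ∫ x, f x ∂(gaussianReal 0 1)),
           √T * (1 / T * timeIntegral Y g T ω - ∫ x, g x ∂(gaussianReal 0 1))) ∂P)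
        atTop (nhds (∫ x, φ (x 0, x 1) ∂(multivariateGaussian 0 S))) := by
  set a := ∫ x, f x ∂(gaussianReal 0 1)
  set b := ∫ x, g x ∂(gaussianReal 0 1)
  have if1 := hf.integrable (by norm_num : (1 : ENNReal) ≤ 2)
  have ig1 := hg.integrable (by norm_num : (1 : ENNReal) ≤ 2)
  have mf' : Measurable fun y => f y - a := mf.sub_const a
  have mg' : Measurable fun y => g y - b := mg.sub_const b
  have hf' : MemLp (fun y => f y - a) 2 (gaussianReal 0 1) := hf.sub (memLp_const a)
  have hg' : MemLp (fun y => g y - b) 2 (gaussianReal 0 1) := hg.sub (memLp_const b)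
  have hf0 : ∫ y, (f y - a) ∂(gaussianReal 0 1) = 0 := by
    rw [integral_sub if1 (integrable_const a)]; simp [a]
  have hg0 : ∫ y, (g y - b) ∂(gaussianReal 0 1) = 0 := by
    rw [integral_sub ig1 (integrable_const b)]; simp [b]
  have hS := hY.posSemidef_asymptoticCov hr mf' hf' hf0 mg' hg' hg0
  refine ⟨_, hS, tendsto_integral_of_tendsto_charFun (fun T => ?_) (fun T => ?_) hS fun c d => ?_⟩
  · exact (((hY.stronglyMeasurable_timeIntegral mf).measurable.const_mul _).sub_const _).const_mul _
  · exact (((hY.stronglyMeasurable_timeIntegral mg).measurable.const_mul _).sub_const _).const_mul _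
  · have h := hY.tendsto_integral_cexp hr ((mf'.const_smul c).add (mg'.const_smul d))
      ((hf'.const_smul c).add (hg'.const_smul d))
      (integral_smul_add_smul_eq_zero hf' hf0 hg' hg0 c d)
    rw [hY.integral_autocov_eq_asymptoticCov hr mf' hf' hf0 mg' hg' hg0] at h
    refine h.congr' ?_
    filter_upwards [eventually_gt_atTop 0] with T hT
    refine integral_congr_ae ?_
    filter_upwards [hY.ae_normalized_average_eq mf if1 mg ig1 a b c d hT] with ω hω
    rw [hω]

end IsStationaryGaussian

/-- Theorem 3.2, case (1): central limit theorem for the moment estimators under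
short-range dependence (`r ∈ L¹(ℝ)`). Convergence in distribution is expressed via
bounded continuous test functions, and the limiting centered bivariate Gaussian law is
characterised by the Gaussianity of all its linear functionals. -/
theorem moment_estimator_clt_short_range
    {Ω : Type*} [MeasurableSpace Ω] (P : Measure Ω) [IsProbabilityMeasure P]
    (Y : ℝ → Ω → ℝ) (hYmeas : Measurable (Function.uncurry Y))
    (r : ℝ → ℝ) (hreven : ∀ t, r (-t) = r t) (hr0 : r 0 = 1)
    (hGauss : ∀ (k : ℕ) (t c : Fin k → ℝ), (∀ i, 0 ≤ t i) →
      P.map (fun ω => ∑ i, c i * Y (t i) ω)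
        = gaussianReal 0 (Real.toNNReal (∑ i, ∑ j, c i * c j * r (t i - t j))))
    (hrL1 : Integrable r)
    (αp αm : ℝ) (hαp : 0 < αp) (hαm : 0 < αm) (hne : αp ≠ αm)
    (X : ℝ → Ω → ℝ)
    (hX : ∀ t ω, X t ω = αp * Y t ω * (if 0 < Y t ω then (1 : ℝ) else 0)
            + αm * Y t ω * (if Y t ω < 0 then (1 : ℝ) else 0))
    (m1 m2 : ℝ → Ω → ℝ)
    (hm1 : ∀ T ω, m1 T ω = (1 / T) * ∫ u in Set.Ioc (0 : ℝ) T, X u ω)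
    (hm2 : ∀ T ω, m2 T ω = (1 / T) * ∫ u in Set.Ioc (0 : ℝ) T, (X u ω) ^ 2)
    (μ1 μ2 : ℝ)
    (hμ1 : μ1 = (αp - αm) / Real.sqrt (2 * π))
    (hμ2 : μ2 = (αp ^ 2 + αm ^ 2) / 2) :
    ∃ S : Matrix (Fin 2) (Fin 2) ℝ, S.PosSemidef ∧
      ∃ μ : Measure (ℝ × ℝ), IsProbabilityMeasure μ ∧
        (∀ c d : ℝ, μ.map (fun x => c * x.1 + d * x.2)
          = gaussianReal 0
              (Real.toNNReal (c ^ 2 * S 0 0 + 2 * c * d * S 0 1 + d ^ 2 * S 1 1)))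
        ∧ ∀ f : BoundedContinuousFunction (ℝ × ℝ) ℝ,
            Tendsto (fun T : ℝ =>
                ∫ ω, f (Real.sqrt T * (m1 T ω - μ1), Real.sqrt T * (m2 T ω - μ2)) ∂P)
              atTop (nhds (∫ x, f x ∂μ)) := by
  have hY : IsStationaryGaussian P Y r := ⟨hYmeas, hreven, hr0, hGauss⟩
  obtain ⟨S, hS, h⟩ := hY.tendsto_integral_normalized_average hrL1 (measurable_oscillate αp αm)
    ((memLp_oscillate αp αm).mono_exponent (by norm_num))
    ((measurable_oscillate αp αm).pow_const 2) (memLp_oscillate_sq αp αm)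
  refine ⟨S, hS, (multivariateGaussian 0 S).map (fun x => (x 0, x 1)),
    Measure.isProbabilityMeasure_map (by fun_prop), fun c d => ?_, fun f => ?_⟩
  · rw [Measure.map_map (by fun_prop) (by fun_prop)]
    exact map_multivariateGaussian_fin_two hS c d
  · rw [integral_map (by fun_prop) (by fun_prop)]
    have hX' : ∀ t ω, X t ω = oscillate αp αm (Y t ω) := hX
    simp only [hm1, hm2, hX', hμ1, hμ2]
    simpa only [integral_oscillate, integral_oscillate_sq, timeIntegral] using h f
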